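/- (Trilinear estimate in Bourgain spaces.) Let $\frac{2}{3} < \alpha < 1$, $\gamma > \frac{1}{2} - \frac{\alpha}{4}$, $b > \frac{1}{2}$, $b' > \frac{1}{4}$ with $b' < b$. Then for all $u_1, u_2, u_3$ in the Bourgain space $X^{\gamma,b}_\alpha$, $\|u_1 \overline{u_2} u_3\|_{X^{\gamma, -b'}_\alpha} \leq C \|u_1\|_{X^{\gamma,b}_\alpha}\|u_2\|_{X^{\gamma,b}_\alpha}\|u_3\|_{X^{\gamma,b}_\alpha}$. -/

import Mathlib

open Real Complex MeasureTheory ENNReal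

noncomputable section

instance : Fact (0 < 2 * π) := ⟨by positivity⟩

/-- The one-dimensional torus. -/
abbrev Torus := AddCircle (2 * π)

/-- Time Fourier transform `(𝓕f)(τ) = ∫ e^{-itτ} f(t) dt`. -/
def timeFT (f : ℝ → ℂ) (τ : ℝ) : ℂ :=
  ∫ t : ℝ, Complex.exp (-Complex.I * (τ : ℂ) * (t : ℂ)) * f t

/-- The Bourgain norm squared `‖u‖²_{X^{s,b}_α}` of a space-time function
`u : ℝ → 𝕋 → ℂ`, via the space-time Fourier transform. -/
def bourgainNormSq (α s b : ℝ) (u : ℝ → Torus → ℂ) : ℝ≥0∞ :=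
  (ENNReal.ofReal (2 * π))⁻¹ *
    ∑' k : ℤ, ∫⁻ τ : ℝ,
      ENNReal.ofReal ((1 + |(k : ℝ)| ^ 2) ^ s * (1 + |τ + |(k : ℝ)| ^ α| ^ 2) ^ b) *
        (‖timeFT (fun t => fourierCoeff (u t) k) τ‖₊ : ℝ≥0∞) ^ 2

theorem one_sub_rpow_le {α x : ℝ} (hα : 0 < α) (hα1 : α < 1) (hx : 0 ≤ x) (hx1 : x ≤ 1) :
    (1 - x) ^ α ≤ 1 - α * x - α * (1 - α) / 2 * x ^ 2 := by
  let F : ℝ → ℝ := fun y => 1 - α * y - α * (1 - α) / 2 * y ^ 2 - (1 - y) ^ α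
  have hmono : MonotoneOn F (Set.Icc 0 1) := by
    have hderiv : ∀ y ∈ Set.Ioo (0 : ℝ) 1, HasDerivAt F
        (α * (1 - y) ^ (α - 1) - α - α * (1 - α) * y) y := by
      intro y hy
      have h1 : HasDerivAt (fun y : ℝ => (1 - y) ^ α) ((-1) * α * (1 - y) ^ (α - 1)) y :=
        ((hasDerivAt_id y).const_sub 1).rpow_const (Or.inl (by simp; linarith [hy.2]))
      have h2 := ((((hasDerivAt_id y).const_mul α).const_sub 1).sub
        (((hasDerivAt_id y).pow 2).const_mul (α * (1 - α) / 2))).sub h1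
      refine h2.congr_deriv ?_
      simp
      ring
    apply monotoneOn_of_deriv_nonneg (convex_Icc 0 1)
    · apply ContinuousOn.sub (by fun_prop)
      exact ContinuousOn.rpow_const (by fun_prop) fun _ _ => Or.inr hα.le
    · rw [interior_Icc]
      exact fun y hy => (hderiv y hy).differentiableAt.differentiableWithinAt
    · rw [interior_Icc]
      intro y hy
      rw [(hderiv y hy).deriv]
      have hy1 : 0 < 1 - y := by linarith [hy.2]
      have h3 : (1 - y) ^ (1 - α) ≤ 1 - (1 - α) * y := by
        have := rpow_one_add_le_one_add_mul_self (s := -y) (p := 1 - α)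
          (by linarith [hy.2]) (by linarith) (by linarith)
        have e : 1 + -y = 1 - y := by ring
        rw [e] at this
        linarith
      have h4 : (1 - y) ^ (α - 1) * (1 - y) ^ (1 - α) = 1 := by
        rw [← Real.rpow_add hy1]; simp
      have h5 : 0 < (1 - y) ^ (α - 1) := Real.rpow_pos_of_pos hy1 _
      have h6 : 1 ≤ (1 - y) ^ (α - 1) * (1 - (1 - α) * y) := by
        exact h4.symm.le.trans (mul_le_mul_of_nonneg_left h3 h5.le)
      have h7 : 1 + (1 - α) * y ≤ (1 - y) ^ (α - 1) := by
        have h8 : 0 ≤ (1 - α) * y := mul_nonneg (by linarith) hy.1.le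
        have h9 : (1 - α) * y ≤ 1 := by nlinarith [hy.1, hy.2]
        nlinarith [mul_nonneg h5.le (mul_nonneg h8 h8)]
      nlinarith
  have h := hmono (Set.left_mem_Icc.2 zero_le_one) ⟨hx, hx1⟩ hx
  have h0 : F 0 = 0 := by simp [F]
  rw [h0] at h
  simp only [F] at h
  linarith

theorem rpow_sub_rpow_ge {α m n : ℝ} (hα : 0 < α) (hα1 : α < 1) (hm : 0 ≤ m) (hmn : m ≤ n)
    (hn : 0 < n) :
    α * n ^ (α - 1) * (n - m) + α * (1 - α) / 2 * n ^ (α - 2) * (n - m) ^ 2 ≤ n ^ α - m ^ α := by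
  have h := one_sub_rpow_le (x := (n - m) / n) hα hα1 (div_nonneg (by linarith) hn.le)
    ((div_le_one hn).2 (by linarith))
  have e1 : 1 - (n - m) / n = m / n := by field_simp; ring
  rw [e1, Real.div_rpow hm hn.le, div_le_iff₀ (Real.rpow_pos_of_pos hn _)] at h
  rw [Real.rpow_sub hn, Real.rpow_sub hn, Real.rpow_one, Real.rpow_two]
  have e2 : (1 - α * ((n - m) / n) - α * (1 - α) / 2 * ((n - m) / n) ^ 2) * n ^ α =
    n ^ α - (α * (n ^ α / n) * (n - m) + α * (1 - α) / 2 * (n ^ α / n ^ 2) * (n - m) ^ 2) := by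
    field_simp
    ring
  linarith

theorem rpow_sub_rpow_le {α x y : ℝ} (hα : 0 < α) (hα1 : α < 1) (hx : 0 < x) (hxy : x ≤ y) :
    y ^ α - x ^ α ≤ α * x ^ (α - 1) * (y - x) := by
  have h := rpow_one_add_le_one_add_mul_self (s := (y - x) / x) (p := α)
    (by have : 0 ≤ (y - x) / x := div_nonneg (by linarith) hx.le
        linarith) hα.le hα1.le
  have e1 : 1 + (y - x) / x = y / x := by field_simp; ring
  rw [e1, Real.div_rpow (by linarith) hx.le, div_le_iff₀ (Real.rpow_pos_of_pos hx _)] at h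
  rw [Real.rpow_sub hx, Real.rpow_one]
  have e2 : (1 + α * ((y - x) / x)) * x ^ α = x ^ α + α * (x ^ α / x) * (y - x) := by
    field_simp
  linarith

/-- Quadratic separation of the phase `|n|^α + |k - n|^α`, away from its critical point. -/
theorem phase_separation_inner {α k m n : ℝ} (hα : 0 < α) (hα1 : α < 1) (hm : 0 ≤ m) (hmn : m ≤ n)
    (hnk : 2 * n ≤ k) :
    α * (1 - α) / 2 * n ^ (α - 2) * (n - m) ^ 2 ≤
      (n ^ α + (k - n) ^ α) - (m ^ α + (k - m) ^ α) := by
  rcases (hm.trans hmn).eq_or_lt with h0 | hn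
  · have : m = n := by linarith
    simp [this]
  have h1 := rpow_sub_rpow_ge hα hα1 hm hmn hn
  have h2 := rpow_sub_rpow_le (x := k - n) (y := k - m) hα hα1 (by linarith) (by linarith)
  have h3 : (k - n) ^ (α - 1) ≤ n ^ (α - 1) :=
    Real.rpow_le_rpow_of_nonpos hn (by linarith) (by linarith)
  have h4 : α * (k - n) ^ (α - 1) * (k - m - (k - n)) ≤ α * n ^ (α - 1) * (n - m) := by
    have : k - m - (k - n) = n - m := by ring
    rw [this]
    have : 0 ≤ n - m := by linarith
    gcongr
  linarith

theorem phase_separation_outer {α m n l : ℝ} (hα : 0 < α) (hα1 : α < 1) (hm : 0 ≤ m) (hmn : m ≤ n)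
    (hl : 0 ≤ m + l) :
    α * (1 - α) / 2 * n ^ (α - 2) * (n - m) ^ 2 ≤
      (n ^ α + (n + l) ^ α) - (m ^ α + (m + l) ^ α) := by
  rcases (hm.trans hmn).eq_or_lt with h0 | hn
  · have : m = n := by linarith
    simp [this]
  have h1 := rpow_sub_rpow_ge hα hα1 hm hmn hn
  have h2 : (m + l) ^ α ≤ (n + l) ^ α := Real.rpow_le_rpow hl (by linarith) hα.le
  have h3 : 0 ≤ α * n ^ (α - 1) * (n - m) := by
    have : 0 ≤ n - m := by linarith
    positivity
  linarith

theorem summable_int_one_add_sq_rpow {p : ℝ} (hp : 1 / 2 < p) :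
    Summable fun n : ℤ => (1 + (n : ℝ) ^ 2) ^ (-p) := by
  have h := Real.summable_abs_int_rpow (b := 2 * p) (by linarith)
  refine Summable.of_norm_bounded_eventually h ?_
  filter_upwards [(Set.finite_singleton (0 : ℤ)).compl_mem_cofinite] with n hn
  have hn : (0 : ℝ) < |(n : ℝ)| := by
    have : n ≠ 0 := hn
    positivity
  rw [Real.norm_of_nonneg (by positivity),
    show -(2 * p) = (2 : ℝ) * (-p) by ring, Real.rpow_mul hn.le, Real.rpow_two, sq_abs]
  exact Real.rpow_le_rpow_of_nonpos (by rw [← sq_abs]; positivity) (by linarith) (by linarith)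

/-- A single term of the counting sum, relative to the minimiser `l` of the modulation. -/
theorem counting_term_le {α γ b p q c : ℝ} {n l : ℤ} {x : ℝ} (hα : 0 < α) (hα1 : α < 1) (hp : 0 < p)
    (hpb : p ≤ 4 * b) (hpγ : p * (2 - α) ≤ 4 * γ) (hq : q = 2 * γ + p * α / 2) (hc : 0 < c)
    (hnl : n ≠ l)
    (hx : c * max |(n : ℝ)| |(l : ℝ)| ^ (α - 2) * ((n : ℝ) - l) ^ 2 ≤ |x|) :
    (1 + (n : ℝ) ^ 2) ^ (-γ) * (1 + x ^ 2) ^ (-b) ≤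
      c ^ (-(p / 2)) * 8 ^ p *
        ((1 + ((n - l : ℤ) : ℝ) ^ 2) ^ (-(p / 2)) + (1 + (n : ℝ) ^ 2) ^ (-(q / 2))) := by
  set M := max |(n : ℝ)| |(l : ℝ)|
  set A := 1 + (n : ℝ) ^ 2 with hA
  set D := 1 + ((n - l : ℤ) : ℝ) ^ 2 with hD
  have hA1 : 1 ≤ A := by rw [hA]; nlinarith [sq_nonneg (n : ℝ)]
  have hM1 : 1 ≤ M := by
    by_contra! h
    have h1 := (le_max_left _ _).trans_lt h
    have h2 := (le_max_right _ _).trans_lt h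
    have h3 : |n| < 1 := by exact_mod_cast h1
    have h4 : |l| < 1 := by exact_mod_cast h2
    rw [Int.abs_lt_one_iff] at h3 h4
    exact hnl (h3.trans h4.symm)
  have hd1 : (1 : ℝ) ≤ ((n : ℝ) - l) ^ 2 := by
    have : 1 ≤ (n - l) ^ 2 := by
      have : 0 < (n - l) ^ 2 := by have := sub_ne_zero.2 hnl; positivity
      linarith
    exact_mod_cast this
  have hDle : D ≤ 2 * ((n : ℝ) - l) ^ 2 := by rw [hD]; push_cast; linarith
  have hD1 : 1 ≤ D := by rw [hD]; nlinarith [sq_nonneg (((n - l : ℤ) : ℝ))]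
  have hMpos : 0 < M := by linarith
  set y := c * M ^ (α - 2) * ((n : ℝ) - l) ^ 2 with hy
  have hMα : 0 < M ^ (α - 2) := Real.rpow_pos_of_pos hMpos _
  have hypos : 0 < y := by positivity
  have h1 : (1 + x ^ 2) ^ (-b) ≤ y ^ (-(p / 2)) := by
    calc (1 + x ^ 2) ^ (-b) ≤ (1 + x ^ 2) ^ (-(p / 4)) :=
          Real.rpow_le_rpow_of_exponent_le (by nlinarith [sq_nonneg x]) (by linarith)
      _ ≤ (y ^ 2) ^ (-(p / 4)) := by
          apply Real.rpow_le_rpow_of_nonpos (by positivity) _ (by linarith)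
          have : y ^ 2 ≤ |x| ^ 2 := by gcongr
          rw [sq_abs] at this; linarith
      _ = y ^ (-(p / 2)) := by
          rw [← Real.rpow_natCast, ← Real.rpow_mul hypos.le]; congr 1; push_cast; ring
  have h2 : y ^ (-(p / 2)) = c ^ (-(p / 2)) * (M ^ (p * (2 - α) / 2) *
      (((n : ℝ) - l) ^ 2) ^ (-(p / 2))) := by
    rw [hy, Real.mul_rpow (by positivity) (by positivity), Real.mul_rpow hc.le (by positivity),
      ← Real.rpow_mul hMpos.le, mul_assoc]
    congr 3; ring
  have hcp : 0 < c ^ (-(p / 2)) := Real.rpow_pos_of_pos hc _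
  have h3 : A ^ (-γ) * (1 + x ^ 2) ^ (-b) ≤ c ^ (-(p / 2)) * (A ^ (-γ) * (M ^ (p * (2 - α) / 2) *
      (((n : ℝ) - l) ^ 2) ^ (-(p / 2)))) := by
    have : A ^ (-γ) * (1 + x ^ 2) ^ (-b) ≤ A ^ (-γ) * y ^ (-(p / 2)) := by gcongr
    rw [h2] at this
    linarith
  refine h3.trans ?_
  rw [mul_assoc]
  refine mul_le_mul_of_nonneg_left ?_ hcp.le
  have hpα : 0 < p * (2 - α) := mul_pos hp (by linarith)
  by_cases hcase : |(l : ℝ)| ≤ 2 * |(n : ℝ)|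
  · have hMA : M ^ (p * (2 - α) / 2) ≤ 4 ^ p * A ^ γ := by
      have hMn : M ^ 2 ≤ 4 * A := by
        have : M ≤ 2 * |(n : ℝ)| := max_le (by linarith [abs_nonneg (n : ℝ)]) hcase
        have : M ^ 2 ≤ (2 * |(n : ℝ)|) ^ 2 := by gcongr
        rw [mul_pow, sq_abs] at this
        rw [hA]; linarith
      calc M ^ (p * (2 - α) / 2) = (M ^ 2) ^ (p * (2 - α) / 4) := by
            rw [← Real.rpow_natCast, ← Real.rpow_mul hMpos.le]; congr 1; push_cast; ring
        _ ≤ (4 * A) ^ (p * (2 - α) / 4) := Real.rpow_le_rpow (by positivity) hMn (by linarith)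
        _ = 4 ^ (p * (2 - α) / 4) * A ^ (p * (2 - α) / 4) :=
            Real.mul_rpow (by norm_num) (by linarith)
        _ ≤ 4 ^ p * A ^ γ := by
            gcongr
            · norm_num
            · nlinarith
            · linarith
    have hDp : (((n : ℝ) - l) ^ 2) ^ (-(p / 2)) ≤ 2 ^ p * D ^ (-(p / 2)) := by
      calc (((n : ℝ) - l) ^ 2) ^ (-(p / 2)) ≤ (D / 2) ^ (-(p / 2)) :=
            Real.rpow_le_rpow_of_nonpos (by linarith) (by linarith) (by linarith)
        _ = 2 ^ (p / 2) * D ^ (-(p / 2)) := by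
            rw [Real.div_rpow (by linarith) (by norm_num), Real.rpow_neg (by norm_num : (0:ℝ) ≤ 2)]
            field_simp
        _ ≤ 2 ^ p * D ^ (-(p / 2)) := by
            gcongr
            · norm_num
            · linarith
    calc A ^ (-γ) * (M ^ (p * (2 - α) / 2) * (((n : ℝ) - l) ^ 2) ^ (-(p / 2)))
        ≤ A ^ (-γ) * ((4 ^ p * A ^ γ) * (2 ^ p * D ^ (-(p / 2)))) := by gcongr
      _ = (A ^ (-γ) * A ^ γ) * (4 ^ p * 2 ^ p) * D ^ (-(p / 2)) := by ring
      _ = 8 ^ p * D ^ (-(p / 2)) := by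
          rw [← Real.rpow_add (by linarith), ← Real.mul_rpow (by norm_num) (by norm_num)]
          norm_num
      _ ≤ _ := by
          gcongr
          have : 0 ≤ A ^ (-(q / 2)) := by positivity
          linarith
  · push Not at hcase
    have hMl : M = |(l : ℝ)| := max_eq_right (by linarith [abs_nonneg (n : ℝ)])
    have hdl : M ^ 2 / 4 ≤ ((n : ℝ) - l) ^ 2 := by
      have h5 : |(l : ℝ)| - |(n : ℝ)| ≤ |(n : ℝ) - l| := by
        rw [abs_sub_comm]; exact abs_sub_abs_le_abs_sub _ _
      have h6 : M / 2 ≤ |(n : ℝ) - l| := by rw [hMl]; linarith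
      have : (M / 2) ^ 2 ≤ |(n : ℝ) - l| ^ 2 := by gcongr
      rw [sq_abs] at this; linarith
    have hAM : A ≤ M ^ 2 := by
      have : 2 * |n| + 1 ≤ |l| := by
        have : 2 * |n| < |l| := by exact_mod_cast hcase
        linarith
      have : 2 * |(n : ℝ)| + 1 ≤ |(l : ℝ)| := by exact_mod_cast this
      rw [hMl, hA]
      nlinarith [abs_nonneg (n : ℝ), sq_abs (n : ℝ)]
    have h7 : (((n : ℝ) - l) ^ 2) ^ (-(p / 2)) ≤ 2 ^ p * M ^ (-p) := by
      calc (((n : ℝ) - l) ^ 2) ^ (-(p / 2)) ≤ ((M / 2) ^ 2) ^ (-(p / 2)) :=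
            Real.rpow_le_rpow_of_nonpos (by positivity) (by linarith) (by linarith)
        _ = (M / 2) ^ (-p) := by
            rw [← Real.rpow_natCast, ← Real.rpow_mul (by positivity)]; congr 1; push_cast; ring
        _ = _ := by
            rw [Real.div_rpow (by linarith) (by norm_num), Real.rpow_neg (by norm_num : (0:ℝ) ≤ 2)]
            field_simp
    calc A ^ (-γ) * (M ^ (p * (2 - α) / 2) * (((n : ℝ) - l) ^ 2) ^ (-(p / 2)))
        ≤ A ^ (-γ) * (M ^ (p * (2 - α) / 2) * (2 ^ p * M ^ (-p))) := by gcongr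
      _ = A ^ (-γ) * (2 ^ p * (M ^ 2) ^ (-(p * α / 4))) := by
          rw [← Real.rpow_natCast M 2, ← Real.rpow_mul hMpos.le, mul_left_comm (M ^ _),
            ← Real.rpow_add hMpos]
          congr 3; push_cast; ring
      _ ≤ A ^ (-γ) * (2 ^ p * A ^ (-(p * α / 4))) := by
          gcongr A ^ (-γ) * (2 ^ p * ?_)
          exact Real.rpow_le_rpow_of_nonpos (by linarith) hAM (by have := mul_pos hp hα; linarith)
      _ = 2 ^ p * A ^ (-(q / 2)) := by
          rw [mul_left_comm, ← Real.rpow_add (by linarith)]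
          congr 2; rw [hq]; ring
      _ ≤ _ := by
          have : 0 ≤ D ^ (-(p / 2)) := by positivity
          gcongr
          · norm_num
          · linarith

/-- Counting bound for a modulation with quadratically separated values. -/
theorem exists_counting_bound_of_separated {α γ b c : ℝ} (hα : 0 < α) (hα1 : α < 1)
    (hγ : 1 / 2 - α / 4 < γ) (hb : 1 / 4 < b) (hc : 0 < c) :
    ∃ K : ℝ, 0 ≤ K ∧ ∀ (s : Finset ℤ) (φ : ℤ → ℝ),
      (∀ m ∈ s, ∀ n ∈ s, |m| ≤ |n| →
        c * |(n : ℝ)| ^ (α - 2) * ((n : ℝ) - m) ^ 2 ≤ |φ n - φ m|) →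
      ∑ n ∈ s, (1 + (n : ℝ) ^ 2) ^ (-γ) * (1 + φ n ^ 2) ^ (-b) ≤ K := by
  obtain ⟨p, hp1, hp2⟩ : ∃ p, 1 < p ∧ p < min (4 * b) (4 * γ / (2 - α)) := by
    apply exists_between
    rw [lt_min_iff, lt_div_iff₀ (by linarith)]
    constructor <;> linarith
  rw [lt_min_iff, lt_div_iff₀ (by linarith)] at hp2
  set q := 2 * γ + p * α / 2 with hq
  have hq1 : 1 < q := by nlinarith
  have hs1 := summable_int_one_add_sq_rpow (p := p / 2) (by linarith)
  have hs2 := summable_int_one_add_sq_rpow (p := q / 2) (by linarith)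
  set S1 := ∑' n : ℤ, (1 + (n : ℝ) ^ 2) ^ (-(p / 2))
  set S2 := ∑' n : ℤ, (1 + (n : ℝ) ^ 2) ^ (-(q / 2))
  have hS1 : 0 ≤ S1 := tsum_nonneg fun n => by positivity
  have hS2 : 0 ≤ S2 := tsum_nonneg fun n => by positivity
  set R := 1 + (c / 2) ^ (-(p / 2)) * 8 ^ p with hR
  have hR0 : 0 ≤ (c / 2) ^ (-(p / 2)) * 8 ^ p := by positivity
  refine ⟨R * (S1 + S2), by positivity, fun s φ h => ?_⟩
  rcases s.eq_empty_or_nonempty with rfl | hs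
  · simp; positivity
  obtain ⟨l, hl, hmin⟩ := s.exists_min_image (fun n => |φ n|) hs
  have hterm : ∀ n ∈ s, (1 + (n : ℝ) ^ 2) ^ (-γ) * (1 + φ n ^ 2) ^ (-b) ≤
      R * ((1 + ((n - l : ℤ) : ℝ) ^ 2) ^ (-(p / 2)) + (1 + (n : ℝ) ^ 2) ^ (-(q / 2))) := by
    intro n hn
    have hpos : 0 ≤ (1 + (n : ℝ) ^ 2) ^ (-(q / 2)) := by positivity
    by_cases hnl : n = l
    · subst hnl
      have h1 : (1 + (n : ℝ) ^ 2) ^ (-γ) ≤ 1 :=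
        Real.rpow_le_one_of_one_le_of_nonpos (by nlinarith [sq_nonneg (n : ℝ)]) (by linarith)
      have h2 : (1 + φ n ^ 2) ^ (-b) ≤ 1 :=
        Real.rpow_le_one_of_one_le_of_nonpos (by nlinarith [sq_nonneg (φ n)]) (by linarith)
      have h3 : (1 + (n : ℝ) ^ 2) ^ (-γ) * (1 + φ n ^ 2) ^ (-b) ≤ 1 * 1 := by gcongr
      simp only [sub_self, Int.cast_zero, ne_eq, OfNat.ofNat_ne_zero, not_false_eq_true, zero_pow,
        add_zero, Real.one_rpow]
      nlinarith
    · refine (counting_term_le (c := c / 2) hα hα1 (by linarith) hp2.1.le hp2.2.le hq (by linarith)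
        hnl ?_).trans ?_
      · have h1 := hmin n hn
        have h2 : |φ n - φ l| ≤ 2 * |φ n| := (abs_sub _ _).trans (by linarith)
        have h3 : c * max |(n : ℝ)| |(l : ℝ)| ^ (α - 2) * ((n : ℝ) - l) ^ 2 ≤ |φ n - φ l| := by
          rcases le_total |l| |n| with hh | hh
          · rw [max_eq_left (by exact_mod_cast hh)]
            exact h l hl n hn hh
          · rw [max_eq_right (by exact_mod_cast hh), abs_sub_comm,
              show ((n : ℝ) - l) ^ 2 = ((l : ℝ) - n) ^ 2 by ring]
            exact h n hn l hl hh
        linarith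
      · gcongr
        linarith
  calc _ ≤ ∑ n ∈ s, R * ((1 + ((n - l : ℤ) : ℝ) ^ 2) ^ (-(p / 2)) +
        (1 + (n : ℝ) ^ 2) ^ (-(q / 2))) := Finset.sum_le_sum hterm
    _ = R * (∑ n ∈ s, (1 + ((n - l : ℤ) : ℝ) ^ 2) ^ (-(p / 2)) +
        ∑ n ∈ s, (1 + (n : ℝ) ^ 2) ^ (-(q / 2))) := by
      rw [← Finset.mul_sum, Finset.sum_add_distrib]
    _ ≤ R * (S1 + S2) := by
      gcongr
      · have hs1' := (Equiv.subRight l).summable_iff.2 hs1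
        have := hs1'.sum_le_tsum s fun n _ => by simp only [Function.comp]; positivity
        refine this.trans_eq ?_
        exact (Equiv.subRight l).tsum_eq fun n : ℤ => (1 + (n : ℝ) ^ 2) ^ (-(p / 2))
      · exact hs2.sum_le_tsum s fun n _ => by positivity

theorem exists_counting_bound_of_nonneg {α γ b : ℝ} (hα : 0 < α) (hα1 : α < 1)
    (hγ : 1 / 2 - α / 4 < γ) (hb : 1 / 4 < b) :
    ∃ K : ℝ, 0 ≤ K ∧ ∀ (s : Finset ℤ) (k : ℤ) (a : ℝ), 0 ≤ k →
      ∑ n ∈ s, (1 + (n : ℝ) ^ 2) ^ (-γ) *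
        (1 + (a + |(n : ℝ)| ^ α + |((k - n : ℤ) : ℝ)| ^ α) ^ 2) ^ (-b) ≤ K := by
  have hc : 0 < α * (1 - α) / 2 := by have := mul_pos hα (sub_pos.2 hα1); linarith
  obtain ⟨K, hK, h⟩ := exists_counting_bound_of_separated hα hα1 hγ hb hc
  refine ⟨K + K + (K + K), by positivity, fun s k a hk => ?_⟩
  set f : ℤ → ℝ := fun n => (1 + (n : ℝ) ^ 2) ^ (-γ) *
        (1 + (a + |(n : ℝ)| ^ α + |((k - n : ℤ) : ℝ)| ^ α) ^ 2) ^ (-b) with hf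
  have hk' : (0 : ℝ) ≤ k := by exact_mod_cast hk
  have key : ∀ P : ℤ → Prop, (∀ m n, P m → P n → |m| ≤ |n| →
      α * (1 - α) / 2 * |(n : ℝ)| ^ (α - 2) * ((n : ℝ) - m) ^ 2 ≤
      |(|(n : ℝ)| ^ α + |((k - n : ℤ) : ℝ)| ^ α) - (|(m : ℝ)| ^ α + |((k - m : ℤ) : ℝ)| ^ α)|) →
      ∀ t : Finset ℤ, (∀ n ∈ t, P n) → ∑ n ∈ t, f n ≤ K := by
    intro P hP t ht
    refine h t (fun n => a + |(n : ℝ)| ^ α + |((k - n : ℤ) : ℝ)| ^ α) fun m hm n hn hmn => ?_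
    refine (hP m n (ht m hm) (ht n hn) hmn).trans_eq ?_
    congr 1; ring
  classical
  rw [← Finset.sum_filter_add_sum_filter_not s (fun n => n ≤ 0 ∨ k ≤ n),
    ← Finset.sum_filter_add_sum_filter_not (s.filter (fun n => n ≤ 0 ∨ k ≤ n)) (fun n => n ≤ 0),
    ← Finset.sum_filter_add_sum_filter_not (s.filter (fun n => ¬ (n ≤ 0 ∨ k ≤ n)))
      (fun n => 2 * n ≤ k)]
  refine add_le_add (add_le_add ?_ ?_) (add_le_add ?_ ?_)
  · refine key (fun n => n ≤ 0) (fun m n hm hn hmn => ?_) _ (by simp)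
    rw [abs_of_nonpos hm, abs_of_nonpos hn] at hmn
    have hm' : (m : ℝ) ≤ 0 := by exact_mod_cast hm
    have hn' : (n : ℝ) ≤ 0 := by exact_mod_cast hn
    have hmn' : -(m : ℝ) ≤ -n := by exact_mod_cast hmn
    have h1 := phase_separation_outer (l := k) hα hα1 (by linarith) hmn' (by linarith)
    refine le_trans ?_ (le_abs_self _)
    push_cast
    rw [abs_of_nonpos hm', abs_of_nonpos hn', abs_of_nonneg (by linarith),
      abs_of_nonneg (by linarith)]
    rw [show -(n : ℝ) + k = k - n by ring, show -(m : ℝ) + k = k - m by ring] at h1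
    refine le_trans (le_of_eq ?_) h1
    ring
  · refine key (fun n => k ≤ n) (fun m n hm hn hmn => ?_) _ (by simp; intros; omega)
    rw [abs_of_nonneg (by linarith), abs_of_nonneg (by linarith)] at hmn
    have hm' : (k : ℝ) ≤ m := by exact_mod_cast hm
    have hn' : (k : ℝ) ≤ n := by exact_mod_cast hn
    have hmn' : (m : ℝ) ≤ n := by exact_mod_cast hmn
    have h1 := phase_separation_outer (l := -k) hα hα1 (by linarith) hmn' (by linarith)
    refine le_trans ?_ (le_abs_self _)
    push_cast
    rw [abs_of_nonneg (a := (n : ℝ)) (by linarith), abs_of_nonneg (a := (m : ℝ)) (by linarith),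
      abs_of_nonpos (by linarith), abs_of_nonpos (by linarith)]
    rw [show (n : ℝ) + -k = -(k - n) by ring, show (m : ℝ) + -k = -(k - m) by ring] at h1
    exact h1
  · refine key (fun n => 0 ≤ n ∧ 2 * n ≤ k) (fun m n hm hn hmn => ?_) _
      (by simp; intros; omega)
    rw [abs_of_nonneg (by linarith), abs_of_nonneg (by linarith)] at hmn
    have hm' : (0 : ℝ) ≤ m := by exact_mod_cast hm.1
    have hn' : 2 * (n : ℝ) ≤ k := by exact_mod_cast hn.2
    have hmn' : (m : ℝ) ≤ n := by exact_mod_cast hmn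
    have h1 := phase_separation_inner hα hα1 hm' hmn' hn'
    refine le_trans ?_ (le_abs_self _)
    push_cast
    rwa [abs_of_nonneg (a := (n : ℝ)) (by linarith), abs_of_nonneg (a := (m : ℝ)) (by linarith),
      abs_of_nonneg (by linarith), abs_of_nonneg (by linarith)]
  · refine key (fun n => 0 < n ∧ k ≤ 2 * n ∧ n ≤ k) (fun m n hm hn hmn => ?_) _
      (by simp; intros; omega)
    rw [abs_of_nonneg (by linarith), abs_of_nonneg (by linarith)] at hmn
    have hm' : (0 : ℝ) < m := by exact_mod_cast hm.1
    have hm2 : (k : ℝ) ≤ 2 * m := by exact_mod_cast hm.2.1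
    have hn' : (n : ℝ) ≤ k := by exact_mod_cast hn.2.2
    have hmn' : (m : ℝ) ≤ n := by exact_mod_cast hmn
    have h1 := phase_separation_inner (k := k) (m := k - n) (n := k - m) hα hα1 (by linarith)
      (by linarith) (by linarith)
    rw [abs_sub_comm]
    refine le_trans ?_ (le_abs_self _)
    push_cast
    rw [abs_of_nonneg (a := (n : ℝ)) (by linarith), abs_of_nonneg (a := (m : ℝ)) (by linarith),
      abs_of_nonneg (by linarith), abs_of_nonneg (by linarith)]
    rcases hmn'.eq_or_lt with he | hlt
    · simp [he]
    have h2 : (n : ℝ) ^ (α - 2) ≤ ((k : ℝ) - m) ^ (α - 2) :=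
      Real.rpow_le_rpow_of_nonpos (by linarith) (by linarith) (by linarith)
    have h3 : α * (1 - α) / 2 * (n : ℝ) ^ (α - 2) * ((n : ℝ) - m) ^ 2 ≤
        α * (1 - α) / 2 * ((k : ℝ) - m) ^ (α - 2) * ((k : ℝ) - m - (k - n)) ^ 2 := by
      rw [show (k : ℝ) - m - (k - n) = n - m by ring]
      gcongr
    refine (h3.trans h1).trans_eq ?_
    ring_nf

theorem exists_counting_bound {α γ b : ℝ} (hα : 0 < α) (hα1 : α < 1)
    (hγ : 1 / 2 - α / 4 < γ) (hb : 1 / 4 < b) :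
    ∃ K : ℝ, 0 ≤ K ∧ ∀ (s : Finset ℤ) (k : ℤ) (a : ℝ),
      ∑ n ∈ s, (1 + (n : ℝ) ^ 2) ^ (-γ) *
        (1 + (a + |(n : ℝ)| ^ α + |((k - n : ℤ) : ℝ)| ^ α) ^ 2) ^ (-b) ≤ K := by
  obtain ⟨K, hK, h⟩ := exists_counting_bound_of_nonneg hα hα1 hγ hb
  refine ⟨K, hK, fun s k a => ?_⟩
  rcases le_total 0 k with hk | hk
  · exact h s k a hk
  · have := h (s.map (Equiv.neg ℤ).toEmbedding) (-k) a (by linarith)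
    rw [Finset.sum_map] at this
    refine le_trans (le_of_eq ?_) this
    refine Finset.sum_congr rfl fun n _ => ?_
    simp only [Equiv.coe_toEmbedding, Equiv.neg_apply, Int.cast_neg, Int.cast_sub, abs_neg,
      neg_sq, sub_neg_eq_add]
    push_cast
    rw [abs_sub_comm, show -(k : ℝ) + n = n - k by ring]

theorem sq_lintegral_le_of_sq_le {X : Type*} [MeasurableSpace X] {μ : Measure X}
    {h P Q : X → ℝ≥0∞} (hP : AEMeasurable P μ) (hQ : AEMeasurable Q μ)
    (hh : ∀ x, h x ^ 2 ≤ P x * Q x) :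
    (∫⁻ x, h x ∂μ) ^ 2 ≤ (∫⁻ x, P x ∂μ) * ∫⁻ x, Q x ∂μ := by
  have hsq : ∀ a : ℝ≥0∞, (a ^ (1 / 2 : ℝ)) ^ 2 = a := fun a => by
    rw [← ENNReal.rpow_natCast, ← ENNReal.rpow_mul]; norm_num
  have hsq' : ∀ a : ℝ≥0∞, (a ^ (1 / 2 : ℝ)) ^ (2 : ℝ) = a := fun a => by
    rw [← ENNReal.rpow_mul]; norm_num
  have h1 : ∀ x, h x ≤ P x ^ (1 / 2 : ℝ) * Q x ^ (1 / 2 : ℝ) := fun x => by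
    refine (ENNReal.pow_le_pow_left_iff two_ne_zero).1 ?_
    rw [mul_pow, hsq, hsq]
    exact hh x
  have h2 := ENNReal.lintegral_mul_le_Lp_mul_Lq μ Real.HolderConjugate.two_two
    (hP.pow_const (1 / 2 : ℝ)) (hQ.pow_const (1 / 2 : ℝ))
  simp only [hsq', Pi.mul_apply] at h2
  calc (∫⁻ x, h x ∂μ) ^ 2 ≤ ((∫⁻ x, P x ∂μ) ^ (1 / 2 : ℝ) * (∫⁻ x, Q x ∂μ) ^ (1 / 2 : ℝ)) ^ 2 := by
        gcongr
        exact (lintegral_mono h1).trans h2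
    _ = _ := by rw [mul_pow, hsq, hsq]

theorem sq_lintegral_mul_le {X : Type*} [MeasurableSpace X] {μ : Measure X} {f g : X → ℝ≥0∞}
    (hf : AEMeasurable f μ) (hg : AEMeasurable g μ) :
    (∫⁻ x, f x * g x ∂μ) ^ 2 ≤ (∫⁻ x, f x ^ 2 ∂μ) * ∫⁻ x, g x ^ 2 ∂μ :=
  sq_lintegral_le_of_sq_le (hf.pow_const 2) (hg.pow_const 2) fun _ => (mul_pow _ _ _).le

/-- Duality for weighted `L²` bounds of nonnegative functions. -/
theorem lintegral_inv_mul_sq_le_of_dual {X : Type*} [MeasurableSpace X] {μ : Measure X}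
    [SigmaFinite μ] {w T : X → ℝ≥0∞} {C : ℝ≥0∞} (hw : Measurable w) (hT : Measurable T)
    (hw0 : ∀ x, w x ≠ 0) (hwt : ∀ x, w x ≠ ∞)
    (h : ∀ V : X → ℝ≥0∞, Measurable V →
      (∫⁻ x, V x * T x ∂μ) ^ 2 ≤ C * ∫⁻ x, w x * V x ^ 2 ∂μ) :
    ∫⁻ x, (w x)⁻¹ * T x ^ 2 ∂μ ≤ C := by
  have hwi : Measurable fun x => (w x)⁻¹ := hw.inv
  let f : X → ℝ≥0∞ := fun x => (w x)⁻¹ * T x ^ 2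
  have hf : Measurable f := hwi.mul (hT.pow_const 2)
  let A : ℕ → Set X := fun n =>
    spanningSets μ n ∩ ({x | (w x)⁻¹ ≤ n} ∩ ({x | T x ≤ n} ∪ {x | T x = ∞}))
  let S : ℕ → X → ℝ≥0∞ := fun n x => (A n).indicator (fun x => min (T x) n) x
  have hA : ∀ n, MeasurableSet (A n) := fun n =>
    (measurableSet_spanningSets μ n).inter ((measurableSet_le hwi measurable_const).inter
      ((measurableSet_le hT measurable_const).union (hT (measurableSet_singleton ∞))))
  have hS : ∀ n, Measurable (S n) := fun n => (hT.min measurable_const).indicator (hA n)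
  have hST : ∀ n x, S n x ≤ T x := fun n x => by
    by_cases hx : x ∈ A n <;> simp [S, hx]
  have hfin : ∀ n, ∫⁻ x, (w x)⁻¹ * S n x ^ 2 ∂μ ≠ ∞ := fun n => by
    have h1 : ∀ x, (w x)⁻¹ * S n x ^ 2 ≤
        (spanningSets μ n).indicator (fun _ => (n : ℝ≥0∞) * (n : ℝ≥0∞) ^ 2) x := fun x => by
      by_cases hx : x ∈ A n
      · simp only [S, Set.indicator_of_mem hx, Set.indicator_of_mem hx.1]
        gcongr
        · exact hx.2.1
        · exact min_le_right _ _
      · simp [S, hx]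
    refine ((lintegral_mono h1).trans_lt ?_).ne
    rw [lintegral_indicator (measurableSet_spanningSets μ n), setLIntegral_const]
    exact ENNReal.mul_lt_top (by finiteness) (measure_spanningSets_lt_top μ n)
  have hbound : ∀ n, ∫⁻ x, (w x)⁻¹ * S n x ^ 2 ∂μ ≤ C := fun n => by
    have h1 := h (fun x => (w x)⁻¹ * S n x) (hwi.mul (hS n))
    have h2 : ∫⁻ x, w x * ((w x)⁻¹ * S n x) ^ 2 ∂μ = ∫⁻ x, (w x)⁻¹ * S n x ^ 2 ∂μ :=
      lintegral_congr fun x => by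
        rw [mul_pow, sq (w x)⁻¹, ← mul_assoc, ← mul_assoc, ENNReal.mul_inv_cancel (hw0 x) (hwt x),
          one_mul]
    have h3 : ∫⁻ x, (w x)⁻¹ * S n x ^ 2 ∂μ ≤ ∫⁻ x, (w x)⁻¹ * S n x * T x ∂μ :=
      lintegral_mono fun x => by
        rw [sq, ← mul_assoc]
        gcongr
        exact hST n x
    rw [h2] at h1
    set I := ∫⁻ x, (w x)⁻¹ * S n x ^ 2 ∂μ
    rcases eq_or_ne I 0 with h0 | h0
    · rw [h0]; exact bot_le
    have h4 : I * I ≤ C * I := by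
      rw [← sq]
      exact (pow_le_pow_left' h3 2).trans h1
    exact (ENNReal.mul_le_mul_iff_left h0 (hfin n)).1 h4
  have hlim : ∀ x, f x ≤ Filter.atTop.liminf fun n => (w x)⁻¹ * S n x ^ 2 := fun x => by
    have hev : ∀ᶠ n : ℕ in Filter.atTop, S n x = min (T x) n := by
      obtain ⟨n1, hn1⟩ := Set.mem_iUnion.1 ((iUnion_spanningSets μ).symm ▸ Set.mem_univ x)
      obtain ⟨n2, hn2⟩ := ENNReal.exists_nat_gt (ENNReal.inv_ne_top.2 (hw0 x))
      obtain ⟨n3, hn3⟩ : ∃ n3 : ℕ, ∀ n : ℕ, n3 ≤ n → T x ≤ n ∨ T x = ∞ := by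
        by_cases ht : T x = ∞
        · exact ⟨0, fun _ _ => Or.inr ht⟩
        · obtain ⟨m, hm⟩ := ENNReal.exists_nat_gt ht
          exact ⟨m, fun n hn => Or.inl (hm.le.trans (by exact_mod_cast hn))⟩
      filter_upwards [Filter.eventually_ge_atTop n1, Filter.eventually_ge_atTop n2,
        Filter.eventually_ge_atTop n3] with n h1 h2 h3
      have : x ∈ A n := ⟨monotone_spanningSets μ h1 hn1,
        hn2.le.trans (by exact_mod_cast h2), hn3 n h3⟩
      simp [S, this]
    have ht : Filter.Tendsto (fun n : ℕ => (w x)⁻¹ * (min (T x) n) ^ 2) Filter.atTop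
        (nhds (f x)) := by
      have h1 : Filter.Tendsto (fun n : ℕ => min (T x) (n : ℝ≥0∞)) Filter.atTop
          (nhds (min (T x) ∞)) := tendsto_const_nhds.min ENNReal.tendsto_nat_nhds_top
      rw [min_eq_left le_top] at h1
      exact ENNReal.Tendsto.const_mul (((ENNReal.continuous_pow 2).tendsto _).comp h1)
        (Or.inr (ENNReal.inv_ne_top.2 (hw0 x)))
    have ht' : Filter.Tendsto (fun n : ℕ => (w x)⁻¹ * S n x ^ 2) Filter.atTop (nhds (f x)) :=
      ht.congr' (hev.mono fun n hn => by simp only [hn])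
    exact ht'.liminf_eq.ge
  calc ∫⁻ x, f x ∂μ ≤ ∫⁻ x, Filter.atTop.liminf (fun n => (w x)⁻¹ * S n x ^ 2) ∂μ :=
        lintegral_mono hlim
    _ ≤ Filter.atTop.liminf fun n => ∫⁻ x, (w x)⁻¹ * S n x ^ 2 ∂μ :=
        lintegral_liminf_le fun n => hwi.mul ((hS n).pow_const 2)
    _ ≤ C := Filter.liminf_le_of_le (by isBoundedDefault) fun b hb => by
        obtain ⟨n, hn⟩ := hb.exists
        exact hn.trans (hbound n)

section Convolution

variable {G : Type*} [AddCommGroup G] [MeasurableSpace G] [MeasurableAdd₂ G] [MeasurableSub₂ G]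
  [MeasurableNeg G]
  {μ : Measure G} [SigmaFinite μ] [μ.IsAddLeftInvariant] [μ.IsNegInvariant]

omit [MeasurableNeg G] [μ.IsNegInvariant] in
/-- Weighted bilinear `L²` bound for the convolution of nonnegative functions. -/
theorem lintegral_sq_conv_le {w₀ w₁ F H : G → ℝ≥0∞} {K : ℝ≥0∞} (hw₀ : Measurable w₀)
    (hw₁ : Measurable w₁) (h00 : ∀ x, w₀ x ≠ 0) (h0t : ∀ x, w₀ x ≠ ∞) (h10 : ∀ x, w₁ x ≠ 0)
    (h1t : ∀ x, w₁ x ≠ ∞) (hK : ∀ y, ∫⁻ x, (w₁ x)⁻¹ * (w₀ (y - x))⁻¹ ∂μ ≤ K)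
    (hF : Measurable F) (hH : Measurable H) :
    ∫⁻ y, (∫⁻ x, F x * H (y - x) ∂μ) ^ 2 ∂μ ≤
      K * ((∫⁻ x, w₁ x * F x ^ 2 ∂μ) * ∫⁻ x, w₀ x * H x ^ 2 ∂μ) := by
  have hwF : Measurable fun x => w₁ x * F x ^ 2 := hw₁.mul (hF.pow_const 2)
  have hwH : Measurable fun x => w₀ x * H x ^ 2 := hw₀.mul (hH.pow_const 2)
  have hmeas : Measurable fun p : G × G =>
      (w₁ p.2 * F p.2 ^ 2) * (w₀ (p.1 - p.2) * H (p.1 - p.2) ^ 2) :=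
    (hwF.comp measurable_snd).mul (hwH.comp (measurable_fst.sub measurable_snd))
  have h1 : ∀ y, (∫⁻ x, F x * H (y - x) ∂μ) ^ 2 ≤
      K * ∫⁻ x, (w₁ x * F x ^ 2) * (w₀ (y - x) * H (y - x) ^ 2) ∂μ := fun y => by
    refine (sq_lintegral_le_of_sq_le (P := fun x => (w₁ x)⁻¹ * (w₀ (y - x))⁻¹)
      (Q := fun x => (w₁ x * F x ^ 2) * (w₀ (y - x) * H (y - x) ^ 2)) ?_ ?_ fun x => ?_).trans
      (by gcongr; exact hK y)
    · exact (hw₁.inv.mul (hw₀.inv.comp (measurable_const.sub measurable_id))).aemeasurable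
    · exact (hwF.mul (hwH.comp (measurable_const.sub measurable_id))).aemeasurable
    · refine le_of_eq ?_
      calc (F x * H (y - x)) ^ 2 = 1 * 1 * (F x ^ 2 * H (y - x) ^ 2) := by ring
        _ = ((w₁ x)⁻¹ * w₁ x) * ((w₀ (y - x))⁻¹ * w₀ (y - x)) * (F x ^ 2 * H (y - x) ^ 2) := by
          rw [ENNReal.inv_mul_cancel (h10 x) (h1t x), ENNReal.inv_mul_cancel (h00 _) (h0t _)]
        _ = _ := by ring
  calc _ ≤ ∫⁻ y, K * ∫⁻ x, (w₁ x * F x ^ 2) * (w₀ (y - x) * H (y - x) ^ 2) ∂μ ∂μ :=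
        lintegral_mono h1
    _ = K * ∫⁻ y, ∫⁻ x, (w₁ x * F x ^ 2) * (w₀ (y - x) * H (y - x) ^ 2) ∂μ ∂μ :=
        lintegral_const_mul _ hmeas.lintegral_prod_right'
    _ = K * ∫⁻ x, ∫⁻ y, (w₁ x * F x ^ 2) * (w₀ (y - x) * H (y - x) ^ 2) ∂μ ∂μ := by
        rw [lintegral_lintegral_swap hmeas.aemeasurable]
    _ = _ := by
        congr 1
        rw [← lintegral_mul_const _ hwF]
        refine lintegral_congr fun x => ?_
        have m : Measurable fun y => w₀ (y - x) * H (y - x) ^ 2 :=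
          hwH.comp (measurable_id.sub measurable_const)
        rw [lintegral_const_mul _ m,
          lintegral_sub_right_eq_self (fun z => w₀ z * H z ^ 2) x]

omit [MeasurableSub₂ G] [SigmaFinite μ] in
theorem lintegral_conv_comm (F H : G → ℝ≥0∞) (y : G) :
    ∫⁻ x, F x * H (y - x) ∂μ = ∫⁻ x, H x * F (y - x) ∂μ := by
  rw [← lintegral_sub_left_eq_self (fun x => F x * H (y - x)) y]
  exact lintegral_congr fun x => by rw [_root_.sub_sub_cancel, mul_comm]

omit [AddCommGroup G] [MeasurableAdd₂ G] [MeasurableSub₂ G] [MeasurableNeg G]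
  [μ.IsAddLeftInvariant] [μ.IsNegInvariant] in
theorem lintegral_mul_lintegral_swap {F H f h : G → ℝ≥0∞} {θ η : G → G → G} (hF : Measurable F)
    (hH : Measurable H) (hf : Measurable f) (hh : Measurable h)
    (hθ : Measurable fun p : G × G => θ p.1 p.2) (hη : Measurable fun p : G × G => η p.1 p.2) :
    ∫⁻ z, (∫⁻ x, F x * H (θ z x) ∂μ) * (∫⁻ y, f y * h (η z y) ∂μ) ∂μ =
      ∫⁻ x, ∫⁻ y, F x * f y * ∫⁻ z, H (θ z x) * h (η z y) ∂μ ∂μ ∂μ := by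
  have m1 : ∀ z, Measurable fun x => F x * H (θ z x) := fun z =>
    hF.mul (hH.comp (hθ.comp measurable_prodMk_left))
  have m2 : ∀ z, Measurable fun y => f y * h (η z y) := fun z =>
    hf.mul (hh.comp (hη.comp measurable_prodMk_left))
  have m3 : Measurable fun p : G × G × G =>
      F p.2.1 * H (θ p.1 p.2.1) * (f p.2.2 * h (η p.1 p.2.2)) := by
    refine ((hF.comp measurable_snd.fst).mul (hH.comp (hθ.comp
      (measurable_fst.prodMk measurable_snd.fst)))).mul
      ((hf.comp measurable_snd.snd).mul (hh.comp (hη.comp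
      (measurable_fst.prodMk measurable_snd.snd))))
  calc _ = ∫⁻ z, ∫⁻ p : G × G, F p.1 * H (θ z p.1) * (f p.2 * h (η z p.2)) ∂(μ.prod μ) ∂μ := by
        refine lintegral_congr fun z => ?_
        rw [lintegral_prod_mul (m1 z).aemeasurable (m2 z).aemeasurable]
    _ = ∫⁻ p : G × G, ∫⁻ z, F p.1 * H (θ z p.1) * (f p.2 * h (η z p.2)) ∂μ ∂(μ.prod μ) :=
        lintegral_lintegral_swap m3.aemeasurable
    _ = ∫⁻ x, ∫⁻ y, ∫⁻ z, F x * H (θ z x) * (f y * h (η z y)) ∂μ ∂μ ∂μ := by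
        rw [lintegral_prod]
        exact (Measurable.lintegral_prod_left' (f := fun p : G × G × G =>
          F p.2.1 * H (θ p.1 p.2.1) * (f p.2.2 * h (η p.1 p.2.2))) m3).aemeasurable
    _ = _ := by
        refine lintegral_congr fun x => lintegral_congr fun y => ?_
        rw [← lintegral_const_mul]
        · exact lintegral_congr fun z => by ring
        · exact (hH.comp (hθ.comp measurable_prodMk_right)).mul
            (hh.comp (hη.comp measurable_prodMk_right))

omit [MeasurableNeg G] [μ.IsNegInvariant] in
/-- Correlations and convolutions of nonnegative functions have the same `L²` norm. -/
theorem lintegral_sq_corr_eq {F H : G → ℝ≥0∞} (hF : Measurable F) (hH : Measurable H) :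
    ∫⁻ z, (∫⁻ x, F x * H (z + x) ∂μ) ^ 2 ∂μ = ∫⁻ z, (∫⁻ x, F x * H (z - x) ∂μ) ^ 2 ∂μ := by
  simp only [sq]
  rw [lintegral_mul_lintegral_swap (θ := fun z x => z + x) (η := fun z x => z + x) hF hH hF hH
    (measurable_fst.add measurable_snd) (measurable_fst.add measurable_snd),
    lintegral_mul_lintegral_swap (θ := fun z x => z - x) (η := fun z x => z - x) hF hH hF hH
    (measurable_fst.sub measurable_snd) (measurable_fst.sub measurable_snd)]
  refine lintegral_congr fun x => lintegral_congr fun y => ?_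
  congr 1
  rw [← lintegral_sub_right_eq_self (fun z => H (z + x) * H (z + y)) (x + y)]
  refine lintegral_congr fun z => ?_
  rw [mul_comm]
  congr 2 <;> abel

/-- The trilinear convolution `∫∫ F₁(x) F₂(y) F₃(z - x + y)`. -/
def triConv (μ : Measure G) (F₁ F₂ F₃ : G → ℝ≥0∞) (z : G) : ℝ≥0∞ :=
  ∫⁻ x, ∫⁻ y, F₁ x * F₂ y * F₃ (z - x + y) ∂μ ∂μ

omit [MeasurableNeg G] [μ.IsAddLeftInvariant] [μ.IsNegInvariant] in
theorem measurable_triConv {F₁ F₂ F₃ : G → ℝ≥0∞} (h₁ : Measurable F₁) (h₂ : Measurable F₂)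
    (h₃ : Measurable F₃) : Measurable (triConv μ F₁ F₂ F₃) := by
  refine Measurable.lintegral_prod_right' (f := fun p : G × G =>
    ∫⁻ y, F₁ p.2 * F₂ y * F₃ (p.1 - p.2 + y) ∂μ) ?_
  refine Measurable.lintegral_prod_right' (f := fun q : (G × G) × G =>
    F₁ q.1.2 * F₂ q.2 * F₃ (q.1.1 - q.1.2 + q.2)) ?_
  fun_prop

omit [μ.IsNegInvariant] in
theorem lintegral_mul_triConv {V F₁ F₂ F₃ : G → ℝ≥0∞} (hV : Measurable V) (h₁ : Measurable F₁)
    (h₂ : Measurable F₂) (h₃ : Measurable F₃) :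
    ∫⁻ z, V z * triConv μ F₁ F₂ F₃ z ∂μ =
      ∫⁻ x, ∫⁻ y, F₁ x * F₂ y * ∫⁻ z, V (z + x) * F₃ (z + y) ∂μ ∂μ ∂μ := by
  have m : Measurable fun q : G × G × G =>
      V q.1 * (F₁ q.2.1 * F₂ q.2.2 * F₃ (q.1 - q.2.1 + q.2.2)) := by
    fun_prop
  have m2 : ∀ z, Measurable fun p : G × G => F₁ p.1 * F₂ p.2 * F₃ (z - p.1 + p.2) := fun z => by
    fun_prop
  calc _ = ∫⁻ z, ∫⁻ p : G × G, V z * (F₁ p.1 * F₂ p.2 * F₃ (z - p.1 + p.2)) ∂(μ.prod μ) ∂μ := by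
        refine lintegral_congr fun z => ?_
        rw [lintegral_const_mul _ (m2 z), lintegral_prod _ (m2 z).aemeasurable, triConv]
    _ = ∫⁻ p : G × G, ∫⁻ z, V z * (F₁ p.1 * F₂ p.2 * F₃ (z - p.1 + p.2)) ∂μ ∂(μ.prod μ) :=
        lintegral_lintegral_swap m.aemeasurable
    _ = ∫⁻ x, ∫⁻ y, ∫⁻ z, V z * (F₁ x * F₂ y * F₃ (z - x + y)) ∂μ ∂μ ∂μ := by
        rw [lintegral_prod]
        exact (Measurable.lintegral_prod_left' (f := fun q : G × G × G =>
          V q.1 * (F₁ q.2.1 * F₂ q.2.2 * F₃ (q.1 - q.2.1 + q.2.2))) m).aemeasurable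
    _ = _ := by
        refine lintegral_congr fun x => lintegral_congr fun y => ?_
        rw [← lintegral_const_mul _ (by fun_prop),
          ← lintegral_add_right_eq_self (fun z => V z * (F₁ x * F₂ y * F₃ (z - x + y))) x]
        refine lintegral_congr fun z => ?_
        rw [add_sub_cancel_right]
        ring

omit [μ.IsNegInvariant] in
theorem sq_lintegral_mul_triConv_le_corr {V F₁ F₂ F₃ : G → ℝ≥0∞} (hV : Measurable V)
    (h₁ : Measurable F₁) (h₂ : Measurable F₂) (h₃ : Measurable F₃) :
    (∫⁻ z, V z * triConv μ F₁ F₂ F₃ z ∂μ) ^ 2 ≤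
      (∫⁻ z, (∫⁻ x, F₁ x * V (z - x) ∂μ) ^ 2 ∂μ) * ∫⁻ z, (∫⁻ x, F₂ x * F₃ (z - x) ∂μ) ^ 2 ∂μ := by
  rw [lintegral_mul_triConv hV h₁ h₂ h₃,
    ← lintegral_mul_lintegral_swap (θ := fun z x => z + x) (η := fun z x => z + x) h₁ hV h₂ h₃
      (measurable_fst.add measurable_snd) (measurable_fst.add measurable_snd),
    ← lintegral_sq_corr_eq h₁ hV, ← lintegral_sq_corr_eq h₂ h₃]
  refine sq_lintegral_mul_le (Measurable.aemeasurable ?_) (Measurable.aemeasurable ?_)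
  · exact Measurable.lintegral_prod_right' (f := fun p : G × G => F₁ p.2 * V (p.1 + p.2))
      (by fun_prop)
  · exact Measurable.lintegral_prod_right' (f := fun p : G × G => F₂ p.2 * F₃ (p.1 + p.2))
      (by fun_prop)

omit [μ.IsNegInvariant] in
theorem sq_lintegral_mul_triConv_le_conv {V F₁ F₂ F₃ : G → ℝ≥0∞} (hV : Measurable V)
    (h₁ : Measurable F₁) (h₂ : Measurable F₂) (h₃ : Measurable F₃) :
    (∫⁻ z, V z * triConv μ F₁ F₂ F₃ z ∂μ) ^ 2 ≤
      (∫⁻ z, (∫⁻ x, F₂ x * V (z - x) ∂μ) ^ 2 ∂μ) * ∫⁻ z, (∫⁻ x, F₁ x * F₃ (z - x) ∂μ) ^ 2 ∂μ := by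
  have e : ∫⁻ z, V z * triConv μ F₁ F₂ F₃ z ∂μ =
      ∫⁻ z, (∫⁻ x, F₁ x * F₃ (z - x) ∂μ) * (∫⁻ x, F₂ x * V (z - x) ∂μ) ∂μ := by
    rw [lintegral_mul_triConv hV h₁ h₂ h₃,
      lintegral_mul_lintegral_swap (θ := fun z x => z - x) (η := fun z x => z - x) h₁ h₃ h₂ hV
      (measurable_fst.sub measurable_snd) (measurable_fst.sub measurable_snd)]
    refine lintegral_congr fun x => lintegral_congr fun y => ?_
    congr 1
    rw [← lintegral_sub_right_eq_self (fun z => V (z + x) * F₃ (z + y)) (x + y)]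
    refine lintegral_congr fun z => ?_
    rw [mul_comm]
    congr 2 <;> abel
  rw [e, mul_comm (∫⁻ z, (∫⁻ x, F₂ x * V (z - x) ∂μ) ^ 2 ∂μ)]
  refine sq_lintegral_mul_le (Measurable.aemeasurable ?_) (Measurable.aemeasurable ?_)
  · exact Measurable.lintegral_prod_right' (f := fun p : G × G => F₁ p.2 * F₃ (p.1 - p.2))
      (by fun_prop)
  · exact Measurable.lintegral_prod_right' (f := fun p : G × G => F₂ p.2 * V (p.1 - p.2))
      (by fun_prop)

/-- Weighted trilinear `L²` bound, from the bilinear kernel bound `hK` and the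
subadditivity `hl` of the multiplier `l`. -/
theorem lintegral_sq_triConv_le {w₀ w₁ l F₁ F₂ F₃ : G → ℝ≥0∞} {K C : ℝ≥0∞} (hw₀ : Measurable w₀)
    (hw₁ : Measurable w₁) (hlm : Measurable l) (h00 : ∀ x, w₀ x ≠ 0) (h0t : ∀ x, w₀ x ≠ ∞)
    (h10 : ∀ x, w₁ x ≠ 0) (h1t : ∀ x, w₁ x ≠ ∞)
    (hK : ∀ y, ∫⁻ x, (w₁ x)⁻¹ * (w₀ (y - x))⁻¹ ∂μ ≤ K)
    (hl : ∀ x y z, l z ≤ C * (l x + l y + l (z - x + y)))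
    (hlw : ∀ x, w₀ x * l x ^ 2 ≤ w₁ x)
    (h₁ : Measurable F₁) (h₂ : Measurable F₂) (h₃ : Measurable F₃) :
    ∫⁻ z, (w₀ z)⁻¹ * (l z * triConv μ F₁ F₂ F₃ z) ^ 2 ∂μ ≤
      9 * C ^ 2 * K ^ 2 * ((∫⁻ x, w₁ x * F₁ x ^ 2 ∂μ) * (∫⁻ x, w₁ x * F₂ x ^ 2 ∂μ) *
        ∫⁻ x, w₁ x * F₃ x ^ 2 ∂μ) := by
  have hconv : ∀ {F H : G → ℝ≥0∞}, Measurable F → Measurable H →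
      ∫⁻ y, (∫⁻ x, F x * H (y - x) ∂μ) ^ 2 ∂μ ≤
      K * ((∫⁻ x, w₁ x * F x ^ 2 ∂μ) * ∫⁻ x, w₀ x * H x ^ 2 ∂μ) :=
    fun hF hH => lintegral_sq_conv_le hw₀ hw₁ h00 h0t h10 h1t hK hF hH
  have hN : ∀ F : G → ℝ≥0∞, ∫⁻ x, w₀ x * (l x * F x) ^ 2 ∂μ ≤ ∫⁻ x, w₁ x * F x ^ 2 ∂μ := fun F =>
    lintegral_mono fun x => by
      rw [mul_pow, ← mul_assoc]
      gcongr
      exact hlw x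
  set N₁ := ∫⁻ x, w₁ x * F₁ x ^ 2 ∂μ
  set N₂ := ∫⁻ x, w₁ x * F₂ x ^ 2 ∂μ
  set N₃ := ∫⁻ x, w₁ x * F₃ x ^ 2 ∂μ
  have hm : ∀ {F : G → ℝ≥0∞}, Measurable F → Measurable fun x => l x * F x := fun hF => hlm.mul hF
  have b1 : ∫⁻ z, (w₀ z)⁻¹ * triConv μ (fun x => l x * F₁ x) F₂ F₃ z ^ 2 ∂μ ≤
      K ^ 2 * (N₁ * N₂ * N₃) := by
    refine lintegral_inv_mul_sq_le_of_dual hw₀ (measurable_triConv (hm h₁) h₂ h₃) h00 h0t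
      fun V hV => ?_
    refine (sq_lintegral_mul_triConv_le_conv hV (hm h₁) h₂ h₃).trans ?_
    have e := fun z => lintegral_conv_comm (μ := μ) (fun x => l x * F₁ x) F₃ z
    simp only [e]
    refine (mul_le_mul' (hconv h₂ hV) ((hconv h₃ (hm h₁)).trans
      (mul_le_mul_right (mul_le_mul_right (hN F₁) _) _))).trans_eq ?_
    ring
  have b2 : ∫⁻ z, (w₀ z)⁻¹ * triConv μ F₁ (fun x => l x * F₂ x) F₃ z ^ 2 ∂μ ≤
      K ^ 2 * (N₁ * N₂ * N₃) := by
    refine lintegral_inv_mul_sq_le_of_dual hw₀ (measurable_triConv h₁ (hm h₂) h₃) h00 h0t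
      fun V hV => ?_
    refine (sq_lintegral_mul_triConv_le_corr hV h₁ (hm h₂) h₃).trans ?_
    have e := fun z => lintegral_conv_comm (μ := μ) (fun x => l x * F₂ x) F₃ z
    simp only [e]
    refine (mul_le_mul' (hconv h₁ hV) ((hconv h₃ (hm h₂)).trans
      (mul_le_mul_right (mul_le_mul_right (hN F₂) _) _))).trans_eq ?_
    ring
  have b3 : ∫⁻ z, (w₀ z)⁻¹ * triConv μ F₁ F₂ (fun x => l x * F₃ x) z ^ 2 ∂μ ≤
      K ^ 2 * (N₁ * N₂ * N₃) := by
    refine lintegral_inv_mul_sq_le_of_dual hw₀ (measurable_triConv h₁ h₂ (hm h₃)) h00 h0t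
      fun V hV => ?_
    refine (sq_lintegral_mul_triConv_le_conv hV h₁ h₂ (hm h₃)).trans ?_
    refine (mul_le_mul' (hconv h₂ hV) ((hconv h₁ (hm h₃)).trans
      (mul_le_mul_right (mul_le_mul_right (hN F₃) _) _))).trans_eq ?_
    ring
  set T₁ := triConv μ (fun x => l x * F₁ x) F₂ F₃
  set T₂ := triConv μ F₁ (fun x => l x * F₂ x) F₃
  set T₃ := triConv μ F₁ F₂ (fun x => l x * F₃ x)
  have hsplit : ∀ z, l z * triConv μ F₁ F₂ F₃ z ≤ C * (T₁ z + T₂ z + T₃ z) := fun z => by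
    have i1 : l z * triConv μ F₁ F₂ F₃ z =
        ∫⁻ x, ∫⁻ y, l z * (F₁ x * F₂ y * F₃ (z - x + y)) ∂μ ∂μ := by
      have : ∀ x, ∫⁻ y, l z * (F₁ x * F₂ y * F₃ (z - x + y)) ∂μ =
          l z * ∫⁻ y, F₁ x * F₂ y * F₃ (z - x + y) ∂μ := fun x =>
        lintegral_const_mul _ (by fun_prop)
      simp only [this]
      rw [lintegral_const_mul, triConv]
      exact Measurable.lintegral_prod_right' (f := fun p : G × G =>
        F₁ p.1 * F₂ p.2 * F₃ (z - p.1 + p.2)) (by fun_prop)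
    have i2 : C * (T₁ z + T₂ z + T₃ z) = ∫⁻ x, ∫⁻ y, C * (((l x * F₁ x) * F₂ y * F₃ (z - x + y) +
        F₁ x * (l y * F₂ y) * F₃ (z - x + y)) +
        F₁ x * F₂ y * (l (z - x + y) * F₃ (z - x + y))) ∂μ ∂μ := by
      have : ∀ x, ∫⁻ y, C * (((l x * F₁ x) * F₂ y * F₃ (z - x + y) +
        F₁ x * (l y * F₂ y) * F₃ (z - x + y)) +
        F₁ x * F₂ y * (l (z - x + y) * F₃ (z - x + y))) ∂μ =
        C * (((∫⁻ y, (l x * F₁ x) * F₂ y * F₃ (z - x + y) ∂μ) +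
        (∫⁻ y, F₁ x * (l y * F₂ y) * F₃ (z - x + y) ∂μ)) +
        (∫⁻ y, F₁ x * F₂ y * (l (z - x + y) * F₃ (z - x + y)) ∂μ)) := fun x => by
        rw [lintegral_const_mul _ (by fun_prop), lintegral_add_left (by fun_prop),
          lintegral_add_left (by fun_prop)]
      simp only [this]
      have n1 : Measurable fun x => ∫⁻ y, (l x * F₁ x) * F₂ y * F₃ (z - x + y) ∂μ :=
        Measurable.lintegral_prod_right' (f := fun p : G × G =>
          (l p.1 * F₁ p.1) * F₂ p.2 * F₃ (z - p.1 + p.2)) (by fun_prop)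
      have n2 : Measurable fun x => ∫⁻ y, F₁ x * (l y * F₂ y) * F₃ (z - x + y) ∂μ :=
        Measurable.lintegral_prod_right' (f := fun p : G × G =>
          F₁ p.1 * (l p.2 * F₂ p.2) * F₃ (z - p.1 + p.2)) (by fun_prop)
      have n3 : Measurable fun x => ∫⁻ y, F₁ x * F₂ y * (l (z - x + y) * F₃ (z - x + y)) ∂μ :=
        Measurable.lintegral_prod_right' (f := fun p : G × G =>
          F₁ p.1 * F₂ p.2 * (l (z - p.1 + p.2) * F₃ (z - p.1 + p.2))) (by fun_prop)
      rw [lintegral_const_mul _ (by fun_prop), lintegral_add_left (by fun_prop),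
        lintegral_add_left n1]
      rfl
    rw [i1, i2]
    refine lintegral_mono fun x => lintegral_mono fun y => ?_
    calc l z * (F₁ x * F₂ y * F₃ (z - x + y))
        ≤ (C * (l x + l y + l (z - x + y))) * (F₁ x * F₂ y * F₃ (z - x + y)) := by
          gcongr
          exact hl x y z
      _ = _ := by ring
  have hsq : ∀ a b c : ℝ≥0∞, (a + b + c) ^ 2 ≤ 3 * (a ^ 2 + b ^ 2 + c ^ 2) := fun a b c => by
    have h := ENNReal.inner_le_Lp_mul_Lq (Finset.univ : Finset (Fin 3)) (fun _ => 1) ![a, b, c]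
      Real.HolderConjugate.two_two
    have h2 := pow_le_pow_left' h 2
    rw [mul_pow, ← ENNReal.rpow_natCast, ← ENNReal.rpow_natCast, ← ENNReal.rpow_natCast,
      ← ENNReal.rpow_mul, ← ENNReal.rpow_mul] at h2
    simpa [Fin.sum_univ_three] using h2
  have mT₁ : Measurable T₁ := measurable_triConv (hm h₁) h₂ h₃
  have mT₂ : Measurable T₂ := measurable_triConv h₁ (hm h₂) h₃
  have hwi : Measurable fun x => (w₀ x)⁻¹ := hw₀.inv
  calc _ ≤ ∫⁻ z, 3 * C ^ 2 * (((w₀ z)⁻¹ * T₁ z ^ 2 + (w₀ z)⁻¹ * T₂ z ^ 2) +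
        (w₀ z)⁻¹ * T₃ z ^ 2) ∂μ := by
        refine lintegral_mono fun z => ?_
        calc _ ≤ (w₀ z)⁻¹ * (C * (T₁ z + T₂ z + T₃ z)) ^ 2 :=
              mul_le_mul' le_rfl (pow_le_pow_left' (hsplit z) 2)
          _ ≤ (w₀ z)⁻¹ * (C ^ 2 * (3 * (T₁ z ^ 2 + T₂ z ^ 2 + T₃ z ^ 2))) := by
            rw [mul_pow]; gcongr; exact hsq _ _ _
          _ = _ := by ring
    _ = 3 * C ^ 2 * (((∫⁻ z, (w₀ z)⁻¹ * T₁ z ^ 2 ∂μ) + ∫⁻ z, (w₀ z)⁻¹ * T₂ z ^ 2 ∂μ) +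
        ∫⁻ z, (w₀ z)⁻¹ * T₃ z ^ 2 ∂μ) := by
        have mT₃ : Measurable T₃ := measurable_triConv h₁ h₂ (hm h₃)
        rw [lintegral_const_mul _ (by fun_prop), lintegral_add_left (by fun_prop),
          lintegral_add_left (by fun_prop)]
    _ ≤ 3 * C ^ 2 * ((K ^ 2 * (N₁ * N₂ * N₃) + K ^ 2 * (N₁ * N₂ * N₃)) +
        K ^ 2 * (N₁ * N₂ * N₃)) := by gcongr
    _ = _ := by ring

end Convolution

/-- The measure on the dual group `ℤ × ℝ` of space-time `𝕋 × ℝ`. -/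
abbrev dualMeasure : Measure (ℤ × ℝ) := Measure.count.prod volume

instance : dualMeasure.IsNegInvariant where
  neg_eq_self := by
    have h := (Measure.measurePreserving_neg (Measure.count : Measure ℤ)).prod
      (Measure.measurePreserving_neg (volume : Measure ℝ))
    exact h.map_eq

theorem lintegral_dualMeasure {f : ℤ × ℝ → ℝ≥0∞} (hf : Measurable f) :
    ∫⁻ p, f p ∂dualMeasure = ∑' k : ℤ, ∫⁻ τ : ℝ, f (k, τ) := by
  rw [lintegral_prod _ hf.aemeasurable, lintegral_count]

/-- The weight of the space `X^{s,b}_α` on the Fourier side. -/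
def bourgainWeight (α s b : ℝ) (p : ℤ × ℝ) : ℝ≥0∞ :=
  ENNReal.ofReal ((1 + |(p.1 : ℝ)| ^ 2) ^ s * (1 + |p.2 + |(p.1 : ℝ)| ^ α| ^ 2) ^ b)

@[fun_prop]
theorem measurable_bourgainWeight (α s b : ℝ) : Measurable (bourgainWeight α s b) := by
  refine measurable_from_prod_countable_right fun k => ?_
  unfold bourgainWeight
  fun_prop

theorem bourgainWeight_ne_zero (α s b : ℝ) (p : ℤ × ℝ) : bourgainWeight α s b p ≠ 0 := by
  rw [bourgainWeight, ne_eq, ENNReal.ofReal_eq_zero, not_le]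
  positivity

theorem bourgainWeight_ne_top (α s b : ℝ) (p : ℤ × ℝ) : bourgainWeight α s b p ≠ ∞ :=
  ENNReal.ofReal_ne_top

theorem inv_bourgainWeight (α s b : ℝ) (p : ℤ × ℝ) :
    (bourgainWeight α s b p)⁻¹ = bourgainWeight α (-s) (-b) p := by
  rw [bourgainWeight, bourgainWeight, ← ENNReal.ofReal_inv_of_pos (by positivity), mul_inv,
    ← Real.rpow_neg (by positivity), ← Real.rpow_neg (by positivity)]

theorem bourgainWeight_mul (α s b s' b' : ℝ) (p : ℤ × ℝ) :
    bourgainWeight α s b p * bourgainWeight α s' b' p = bourgainWeight α (s + s') (b + b') p := by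
  rw [bourgainWeight, bourgainWeight, bourgainWeight, ← ENNReal.ofReal_mul (by positivity),
    Real.rpow_add (by positivity), Real.rpow_add (by positivity)]
  congr 1
  ring

theorem bourgainWeight_mono {α s b b' : ℝ} (h : b ≤ b') (p : ℤ × ℝ) :
    bourgainWeight α s b p ≤ bourgainWeight α s b' p := by
  refine ENNReal.ofReal_le_ofReal ?_
  gcongr
  linarith [sq_nonneg |p.2 + |(p.1 : ℝ)| ^ α|]

theorem exists_bourgainWeight_le_add (α : ℝ) {s : ℝ} (hs : 0 ≤ s) :
    ∃ C : ℝ≥0∞, C ≠ ∞ ∧ ∀ x y z : ℤ × ℝ, bourgainWeight α s 0 z ≤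
      C * (bourgainWeight α s 0 x + bourgainWeight α s 0 y + bourgainWeight α s 0 (z - x + y)) := by
  refine ⟨ENNReal.ofReal (9 ^ s), ENNReal.ofReal_ne_top, fun x y z => ?_⟩
  simp only [bourgainWeight, Real.rpow_zero, mul_one]
  rw [← ENNReal.ofReal_add (by positivity) (by positivity), ← ENNReal.ofReal_add (by positivity)
    (by positivity), ← ENNReal.ofReal_mul (by positivity)]
  refine ENNReal.ofReal_le_ofReal ?_
  have key : ∀ k m n : ℤ, (1 + |((k : ℤ) : ℝ)| ^ 2) ≤ 9 * (1 + |(m : ℝ)| ^ 2) ∨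
      (1 + |((k : ℤ) : ℝ)| ^ 2) ≤ 9 * (1 + |(n : ℝ)| ^ 2) ∨
      (1 + |((k : ℤ) : ℝ)| ^ 2) ≤ 9 * (1 + |((k - m + n : ℤ) : ℝ)| ^ 2) := by
    intro k m n
    simp only [sq_abs]
    push_cast
    by_contra! h
    nlinarith [sq_nonneg ((m : ℝ) + n), sq_nonneg ((k : ℝ) - m + n - m),
      sq_nonneg ((k : ℝ) - m + n + n)]
  have p1 : (0 : ℝ) ≤ (1 + |(x.1 : ℝ)| ^ 2) ^ s := by positivity
  have p2 : (0 : ℝ) ≤ (1 + |(y.1 : ℝ)| ^ 2) ^ s := by positivity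
  have p3 : (0 : ℝ) ≤ (1 + |((z - x + y).1 : ℝ)| ^ 2) ^ s := by positivity
  have p9 : (0 : ℝ) ≤ 9 ^ s := by positivity
  have step : ∀ a : ℝ, 1 + |(z.1 : ℝ)| ^ 2 ≤ 9 * (1 + |a| ^ 2) →
      (1 + |(z.1 : ℝ)| ^ 2) ^ s ≤ 9 ^ s * (1 + |a| ^ 2) ^ s := fun a h => by
    rw [← mul_rpow (by norm_num) (by positivity)]
    exact rpow_le_rpow (by positivity) h hs
  rcases key z.1 x.1 y.1 with h | h | h
  · refine (step _ h).trans (mul_le_mul_of_nonneg_left ?_ p9)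
    linarith
  · refine (step _ h).trans (mul_le_mul_of_nonneg_left ?_ p9)
    linarith
  · refine (step _ h).trans (mul_le_mul_of_nonneg_left ?_ p9)
    exact le_add_of_nonneg_left (add_nonneg p1 p2)

theorem lintegral_one_add_sq_rpow_lt_top {b : ℝ} (hb : 1 / 2 < b) :
    ∫⁻ x : ℝ, ENNReal.ofReal ((1 + |x| ^ 2) ^ (-b)) < ∞ := by
  have h := integrable_rpow_neg_one_add_norm_sq (E := ℝ) (μ := volume) (r := 2 * b)
    (by simp only [Module.finrank_self, Nat.cast_one]; linarith)
  have h2 := h.lintegral_lt_top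
  simpa [neg_div] using h2

theorem exists_kernel_bound {α γ b b' : ℝ} (hα : 0 < α) (hα1 : α < 1)
    (hγ : 1 / 2 - α / 4 < γ) (hb : 1 / 2 < b) (hb' : 1 / 4 < b') :
    ∃ K : ℝ≥0∞, K ≠ ∞ ∧ ∀ y : ℤ × ℝ,
      ∫⁻ x, (bourgainWeight α γ b x)⁻¹ * (bourgainWeight α 0 b' (y - x))⁻¹ ∂dualMeasure ≤ K := by
  obtain ⟨K, hK0, hK⟩ := exists_counting_bound hα hα1 hγ hb'
  set g : ℝ → ℝ≥0∞ := fun x => ENNReal.ofReal ((1 + |x| ^ 2) ^ (-b))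
  have hg : Measurable g := by fun_prop
  refine ⟨(∫⁻ x, g x) * ENNReal.ofReal K,
    ENNReal.mul_ne_top (lintegral_one_add_sq_rpow_lt_top hb).ne ENNReal.ofReal_ne_top, ?_⟩
  rintro ⟨k, τ⟩
  let h : ℤ → ℝ → ℝ≥0∞ := fun n x => ENNReal.ofReal ((1 + (n:ℝ)^2)^(-γ) *
    (1 + ((τ - x) + |(n:ℝ)|^α + |((k - n : ℤ):ℝ)|^α)^2)^(-b'))
  have hh : ∀ n, Measurable (h n) := fun n => by fun_prop
  have hm : Measurable fun x : ℤ × ℝ =>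
      (bourgainWeight α γ b x)⁻¹ * (bourgainWeight α 0 b' ((k, τ) - x))⁻¹ := by fun_prop
  have e1 : ∀ n σ, (bourgainWeight α γ b (n, σ))⁻¹ * (bourgainWeight α 0 b' ((k, τ) - (n, σ)))⁻¹ =
      g (σ + |(n : ℝ)| ^ α) * h n (σ + |(n : ℝ)| ^ α) := fun n σ => by
    rw [inv_bourgainWeight, inv_bourgainWeight]
    simp only [bourgainWeight, g, h, neg_zero, Real.rpow_zero, one_mul, Prod.mk_sub_mk, sq_abs]
    rw [← ENNReal.ofReal_mul (by positivity), ← ENNReal.ofReal_mul (by positivity)]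
    congr 1
    rw [show τ - (σ + |(n:ℝ)| ^ α) + |(n:ℝ)| ^ α = τ - σ by ring]
    ring
  calc _ = ∑' n : ℤ, ∫⁻ σ : ℝ, g (σ + |(n : ℝ)| ^ α) * h n (σ + |(n : ℝ)| ^ α) := by
        rw [lintegral_dualMeasure hm]
        simp only [e1]
    _ = ∑' n : ℤ, ∫⁻ x : ℝ, g x * h n x :=
        tsum_congr fun n => lintegral_add_right_eq_self (fun x => g x * h n x) _
    _ = ∫⁻ x : ℝ, ∑' n : ℤ, g x * h n x :=
        (lintegral_tsum fun n => (hg.mul (hh n)).aemeasurable).symm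
    _ ≤ ∫⁻ x, g x * ENNReal.ofReal K := by
        refine lintegral_mono fun x => ?_
        simp only [ENNReal.tsum_mul_left]
        gcongr
        rw [ENNReal.tsum_eq_iSup_sum]
        refine iSup_le fun s => ?_
        rw [← ENNReal.ofReal_sum_of_nonneg fun n _ => by positivity]
        exact ENNReal.ofReal_le_ofReal (hK s k _)
    _ = _ := lintegral_mul_const _ hg

/-- The trilinear estimate on the Fourier side. -/
theorem exists_lintegral_triConv_le {α γ b b' : ℝ} (hα : 0 < α) (hα1 : α < 1)
    (hγ : 1 / 2 - α / 4 < γ) (hb : 1 / 2 < b) (hb' : 1 / 4 < b') (hbb' : b' ≤ b) :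
    ∃ C : ℝ≥0∞, C ≠ ∞ ∧ ∀ F₁ F₂ F₃ : ℤ × ℝ → ℝ≥0∞, Measurable F₁ → Measurable F₂ → Measurable F₃ →
      ∫⁻ p, bourgainWeight α γ (-b') p * triConv dualMeasure F₁ F₂ F₃ p ^ 2 ∂dualMeasure ≤
        C * ((∫⁻ p, bourgainWeight α γ b p * F₁ p ^ 2 ∂dualMeasure) *
          (∫⁻ p, bourgainWeight α γ b p * F₂ p ^ 2 ∂dualMeasure) *
          ∫⁻ p, bourgainWeight α γ b p * F₃ p ^ 2 ∂dualMeasure) := by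
  obtain ⟨K, hKt, hK⟩ := exists_kernel_bound hα hα1 hγ hb hb'
  obtain ⟨C, hCt, hC⟩ := exists_bourgainWeight_le_add α (s := γ / 2) (by linarith)
  refine ⟨9 * C ^ 2 * K ^ 2, by finiteness, fun F₁ F₂ F₃ h₁ h₂ h₃ => ?_⟩
  have e : ∀ p, bourgainWeight α γ (-b') p * triConv dualMeasure F₁ F₂ F₃ p ^ 2 =
      (bourgainWeight α 0 b' p)⁻¹ *
        (bourgainWeight α (γ / 2) 0 p * triConv dualMeasure F₁ F₂ F₃ p) ^ 2 := fun p => by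
    rw [mul_pow, sq (bourgainWeight α (γ / 2) 0 p), bourgainWeight_mul, inv_bourgainWeight,
      ← mul_assoc, bourgainWeight_mul]
    congr 2 <;> ring
  simp only [e]
  refine lintegral_sq_triConv_le (measurable_bourgainWeight _ _ _)
    (measurable_bourgainWeight _ _ _) (measurable_bourgainWeight _ _ _)
    (bourgainWeight_ne_zero _ _ _) (bourgainWeight_ne_top _ _ _)
    (bourgainWeight_ne_zero _ _ _) (bourgainWeight_ne_top _ _ _) hK hC (fun p => ?_) h₁ h₂ h₃
  rw [sq, bourgainWeight_mul, bourgainWeight_mul]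
  simp only [zero_add, add_zero, add_halves]
  exact bourgainWeight_mono hbb' p

open FourierTransform in
theorem integral_fourier_mul_eq_of_integrable {f g : ℝ → ℂ} (hf : Integrable f) (hg : Integrable g) :
    ∫ x, 𝓕 f x * g x = ∫ x, f x * 𝓕 g x := by
  have h := VectorFourier.integral_fourierIntegral_smul_eq_flip (L := innerₗ ℝ)
    Real.continuous_fourierChar continuous_inner hf hg
  rwa [flip_innerₗ] at h

open FourierTransform in
theorem integral_fourierInv_mul_eq_of_integrable {f g : ℝ → ℂ} (hf : Integrable f)
    (hg : Integrable g) : ∫ x, 𝓕⁻ f x * g x = ∫ x, f x * 𝓕⁻ g x := by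
  have h := VectorFourier.integral_fourierIntegral_smul_eq_flip (L := -innerₗ ℝ)
    Real.continuous_fourierChar continuous_inner.neg hf hg
  rwa [show (-innerₗ ℝ : ℝ →ₗ[ℝ] ℝ →ₗ[ℝ] ℝ).flip = -innerₗ ℝ by
    ext; simp] at h

open FourierTransform in
/-- Fourier inversion, almost everywhere. -/
theorem ae_eq_fourierInv_fourier {f : ℝ → ℂ} (hf : Integrable f) (hF : Integrable (𝓕 f)) :
    f =ᵐ[volume] 𝓕⁻ (𝓕 f) := by
  have hc : Continuous (𝓕⁻ (𝓕 f)) :=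
    VectorFourier.fourierIntegral_continuous Real.continuous_fourierChar continuous_inner.neg hF
  refine ae_eq_of_integral_contDiff_smul_eq hf.locallyIntegrable hc.locallyIntegrable
    fun g g_smooth g_cpt => ?_
  have hg₁ : HasCompactSupport (Complex.ofRealCLM ∘ g) := g_cpt.comp_left rfl
  have hg₂ : ContDiff ℝ (⊤ : ℕ∞) (Complex.ofRealCLM ∘ g) :=
    Complex.ofRealCLM.contDiff.comp g_smooth
  set G : SchwartzMap ℝ ℂ := hg₁.toSchwartzMap hg₂
  have hGg : ∀ x, G x = (g x : ℂ) := fun x => rfl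
  have e : ⇑G = 𝓕 (⇑(𝓕⁻ G : SchwartzMap ℝ ℂ)) := by
    rw [← SchwartzMap.fourier_coe, FourierTransform.fourier_fourierInv_eq]
  calc ∫ x, g x • f x = ∫ x, 𝓕 (⇑(𝓕⁻ G : SchwartzMap ℝ ℂ)) x * f x := by
        refine integral_congr_ae (Filter.Eventually.of_forall fun x => ?_)
        rw [← e]
        simp only [hGg, Complex.real_smul]
    _ = ∫ x, 𝓕⁻ (⇑G) x * 𝓕 f x := by
        rw [integral_fourier_mul_eq_of_integrable (𝓕⁻ G : SchwartzMap ℝ ℂ).integrable hf,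
          SchwartzMap.fourierInv_coe]
    _ = ∫ x, G x * 𝓕⁻ (𝓕 f) x := integral_fourierInv_mul_eq_of_integrable G.integrable hF
    _ = _ := by
        refine integral_congr_ae (Filter.Eventually.of_forall fun x => ?_)
        simp only [hGg, Complex.real_smul]

open FourierTransform in
theorem ae_enorm_le_lintegral_fourier {f : ℝ → ℂ} (hf : Integrable f) (hF : Integrable (𝓕 f)) :
    ∀ᵐ t, ‖f t‖ₑ ≤ ∫⁻ ξ, ‖𝓕 f ξ‖ₑ := by
  filter_upwards [ae_eq_fourierInv_fourier hf hF] with t ht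
  rw [ht, Real.fourierInv_eq]
  refine (enorm_integral_le_lintegral_enorm _).trans_eq (lintegral_congr fun ξ => ?_)
  rw [← ofReal_norm, ← ofReal_norm, Circle.norm_smul]

open FourierTransform ComplexConjugate in
theorem fourierInv_conj (f : ℝ → ℂ) (ξ : ℝ) : 𝓕⁻ (fun t => conj (f t)) ξ = conj (𝓕 f ξ) := by
  rw [Real.fourierInv_eq', Real.fourier_eq', ← integral_conj]
  refine integral_congr_ae (Filter.Eventually.of_forall fun t => ?_)
  simp only [smul_eq_mul, map_mul, ← Complex.exp_conj, Complex.conj_ofReal, Complex.conj_I]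
  congr 2
  push_cast
  ring

open FourierTransform ComplexConjugate in
theorem fourier_conj (f : ℝ → ℂ) (ξ : ℝ) : 𝓕 (fun t => conj (f t)) ξ = conj (𝓕 f (-ξ)) := by
  rw [← fourierInv_conj, Real.fourierInv_eq_fourier_neg, neg_neg]

open ComplexConjugate in
theorem MeasureTheory.Integrable.complex_conj {X : Type*} [MeasurableSpace X] {μ : Measure X}
    {f : X → ℂ} (hf : Integrable f μ) : Integrable (fun t => conj (f t)) μ :=
  (Complex.conjCLE : ℂ →L[ℝ] ℂ).integrable_comp hf

open FourierTransform ComplexConjugate in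
theorem lintegral_sq_le_lintegral_sq_fourier {f : ℝ → ℂ} (hf : Integrable f)
    (hF : Integrable (𝓕 f)) : ∫⁻ t, ‖f t‖ₑ ^ 2 ≤ ∫⁻ ξ, ‖𝓕 f ξ‖ₑ ^ 2 := by
  have hb : ∀ᵐ t, ‖f t‖ ≤ (∫⁻ ξ, ‖𝓕 f ξ‖ₑ).toReal := by
    filter_upwards [ae_enorm_le_lintegral_fourier hf hF] with t ht
    rw [← toReal_enorm]
    exact ENNReal.toReal_mono hF.2.ne ht
  have hff : Integrable fun t => f t * conj (f t) :=
    (hf.complex_conj).bdd_mul hf.1 hb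
  have hsq : ∀ z : ℂ, z * conj z = ((‖z‖ ^ 2 : ℝ) : ℂ) := fun z => by
    rw [Complex.mul_conj, Complex.normSq_eq_norm_sq]
  have hsqe : ∀ z : ℂ, ENNReal.ofReal (‖z‖ ^ 2) = ‖z‖ₑ ^ 2 := fun z => by
    rw [ENNReal.ofReal_pow (norm_nonneg z), ofReal_norm]
  have e1 : ∫ t, f t * conj (f t) = ∫ ξ, 𝓕 f ξ * conj (𝓕 f ξ) := by
    calc ∫ t, f t * conj (f t) = ∫ t, 𝓕⁻ (𝓕 f) t * conj (f t) :=
          integral_congr_ae ((ae_eq_fourierInv_fourier hf hF).mono fun t ht => by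
            simp only [← ht])
      _ = ∫ ξ, 𝓕 f ξ * 𝓕⁻ (fun t => conj (f t)) ξ :=
          integral_fourierInv_mul_eq_of_integrable hF hf.complex_conj
      _ = _ := by simp only [fourierInv_conj]
  have e2 : ∫⁻ t, ‖f t‖ₑ ^ 2 = ‖∫ t, f t * conj (f t)‖ₑ := by
    have hff' : Integrable fun t => ‖f t‖ ^ 2 := by
      refine hff.norm.congr (Filter.Eventually.of_forall fun t => ?_)
      simp [sq]
    simp only [hsq, integral_complex_ofReal]
    rw [← ofReal_norm, Complex.norm_real,
      Real.norm_of_nonneg (integral_nonneg fun t => by positivity),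
      ofReal_integral_eq_lintegral_ofReal hff' (Filter.Eventually.of_forall fun t => by positivity)]
    simp only [hsqe]
  rw [e2, e1]
  refine (enorm_integral_le_lintegral_enorm _).trans_eq (lintegral_congr fun ξ => ?_)
  rw [enorm_mul, RCLike.enorm_conj, sq]

open FourierTransform in
theorem enorm_fourier_mul_le {f h : ℝ → ℂ} (hf : Integrable f) (hF : Integrable (𝓕 f))
    (hh : Integrable h) (ξ : ℝ) :
    ‖𝓕 (fun t => f t * h t) ξ‖ₑ ≤ ∫⁻ η, ‖𝓕 f η‖ₑ * ‖𝓕 h (ξ - η)‖ₑ := by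
  have hh' : Integrable fun t => Real.fourierChar (-(t * ξ)) • h t := by
    refine (integrable_norm_iff ?_).1 ?_
    · exact (Continuous.aestronglyMeasurable (by fun_prop)).smul hh.1
    · simpa only [Circle.norm_smul] using hh.norm
  have e : 𝓕 (fun t => f t * h t) ξ = ∫ η, 𝓕 f η * 𝓕 h (ξ - η) := by
    calc 𝓕 (fun t => f t * h t) ξ = ∫ t, 𝓕⁻ (𝓕 f) t * (Real.fourierChar (-(t * ξ)) • h t) := by
          rw [Real.fourier_real_eq]
          refine integral_congr_ae ((ae_eq_fourierInv_fourier hf hF).mono fun t ht => ?_)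
          simp only [← ht, mul_smul_comm]
      _ = ∫ η, 𝓕 f η * 𝓕⁻ (fun t => Real.fourierChar (-(t * ξ)) • h t) η :=
          integral_fourierInv_mul_eq_of_integrable hF hh'
      _ = _ := by
          refine integral_congr_ae (Filter.Eventually.of_forall fun η => ?_)
          simp only
          congr 1
          rw [Real.fourierInv_eq_fourier_neg, Real.fourier_real_eq, Real.fourier_real_eq]
          refine integral_congr_ae (Filter.Eventually.of_forall fun t => ?_)
          simp only [smul_smul, ← AddChar.map_add_eq_mul]
          congr 2
          ring
  rw [e]
  refine (enorm_integral_le_lintegral_enorm _).trans_eq (lintegral_congr fun η => enorm_mul _ _)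

open FourierTransform ComplexConjugate in
theorem enorm_fourier_conj_mul_le {f h : ℝ → ℂ} (hf : Integrable f) (hF : Integrable (𝓕 f))
    (hh : Integrable h) (ξ : ℝ) :
    ‖𝓕 (fun t => conj (f t) * h t) ξ‖ₑ ≤ ∫⁻ η, ‖𝓕 f η‖ₑ * ‖𝓕 h (ξ + η)‖ₑ := by
  have e : 𝓕 (fun t => conj (f t)) = fun ξ => conj (𝓕 f (-ξ)) := funext (fourier_conj f)
  have hF' : Integrable (𝓕 (fun t => conj (f t))) := by
    rw [e]; exact hF.comp_neg.complex_conj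
  refine (enorm_fourier_mul_le hf.complex_conj hF' hh ξ).trans_eq ?_
  rw [← lintegral_neg_eq_self]
  refine lintegral_congr fun η => ?_
  have := congrFun e (-η)
  simp only [neg_neg] at this
  rw [sub_neg_eq_add]
  congr 1
  rw [← RCLike.enorm_conj (𝓕 f η), ← this]

open FourierTransform ComplexConjugate in
theorem enorm_fourier_mul_conj_mul_le {f g h : ℝ → ℂ} (hf : Integrable f) (hF : Integrable (𝓕 f))
    (hg : Integrable g) (hG : Integrable (𝓕 g)) (hh : Integrable h)
    (hgh : Integrable fun t => conj (g t) * h t) (ξ : ℝ) :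
    ‖𝓕 (fun t => f t * (conj (g t) * h t)) ξ‖ₑ ≤
      ∫⁻ η, ∫⁻ η', ‖𝓕 f η‖ₑ * ‖𝓕 g η'‖ₑ * ‖𝓕 h (ξ - η + η')‖ₑ := by
  refine (enorm_fourier_mul_le hf hF hgh ξ).trans (lintegral_mono fun η => ?_)
  have hc : Measurable fun η' => ‖𝓕 g η'‖ₑ * ‖𝓕 h (ξ - η + η')‖ₑ := by
    have c1 : Continuous (𝓕 g) := 
      VectorFourier.fourierIntegral_continuous Real.continuous_fourierChar continuous_inner hg
    have c2 : Continuous (𝓕 h) := 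
      VectorFourier.fourierIntegral_continuous Real.continuous_fourierChar continuous_inner hh
    fun_prop
  simp only [mul_assoc]
  rw [lintegral_const_mul _ hc]
  gcongr
  exact enorm_fourier_conj_mul_le hg hG hh _

section TimeFourier

open FourierTransform ComplexConjugate

theorem fourier_eq_timeFT (f : ℝ → ℂ) (ξ : ℝ) : 𝓕 f ξ = timeFT f (2 * π * ξ) := by
  rw [Real.fourier_real_eq_integral_exp_smul, timeFT]
  refine integral_congr_ae (Filter.Eventually.of_forall fun t => ?_)
  simp only [smul_eq_mul]
  congr 2
  push_cast
  ring

theorem timeFT_eq_fourier (f : ℝ → ℂ) (τ : ℝ) : timeFT f τ = 𝓕 f (τ / (2 * π)) := by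
  rw [fourier_eq_timeFT]
  congr 1
  field_simp

theorem continuous_timeFT {f : ℝ → ℂ} (hf : Integrable f) : Continuous (timeFT f) := by
  have h : Continuous (𝓕 f) :=
    VectorFourier.fourierIntegral_continuous Real.continuous_fourierChar continuous_inner hf
  rw [funext (timeFT_eq_fourier f)]
  fun_prop

theorem lintegral_comp_two_pi_mul_le {g : ℝ → ℝ≥0∞} (hg : Measurable g) :
    ∫⁻ ξ, g (2 * π * ξ) ≤ ∫⁻ τ, g τ := by
  rw [← lintegral_map (f := g) (g := fun ξ => 2 * π * ξ) hg (by fun_prop),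
    Real.map_volume_mul_left (by positivity), lintegral_smul_measure, smul_eq_mul]
  refine mul_le_of_le_one_left' ?_
  rw [ENNReal.ofReal_le_one, abs_of_nonneg (by positivity)]
  exact inv_le_one_of_one_le₀ (by linarith [Real.pi_gt_three])

theorem integrable_fourier_of_timeFT {f : ℝ → ℂ} (hf : Integrable f)
    (hF : ∫⁻ τ, ‖timeFT f τ‖ₑ ≠ ∞) : Integrable (𝓕 f) := by
  have h : Continuous (𝓕 f) :=
    VectorFourier.fourierIntegral_continuous Real.continuous_fourierChar continuous_inner hf
  refine ⟨h.aestronglyMeasurable, lt_of_le_of_lt ?_ hF.lt_top⟩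
  simp only [fourier_eq_timeFT]
  exact lintegral_comp_two_pi_mul_le (g := fun τ => ‖timeFT f τ‖ₑ)
    (continuous_timeFT hf).enorm.measurable

theorem ae_enorm_le_lintegral_timeFT {f : ℝ → ℂ} (hf : Integrable f)
    (hF : ∫⁻ τ, ‖timeFT f τ‖ₑ ≠ ∞) : ∀ᵐ t, ‖f t‖ₑ ≤ ∫⁻ τ, ‖timeFT f τ‖ₑ := by
  filter_upwards [ae_enorm_le_lintegral_fourier hf (integrable_fourier_of_timeFT hf hF)] with t ht
  refine ht.trans ?_
  simp only [fourier_eq_timeFT]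
  exact lintegral_comp_two_pi_mul_le (g := fun τ => ‖timeFT f τ‖ₑ)
    (continuous_timeFT hf).enorm.measurable

theorem lintegral_sq_le_lintegral_sq_timeFT {f : ℝ → ℂ} (hf : Integrable f)
    (hF : ∫⁻ τ, ‖timeFT f τ‖ₑ ≠ ∞) : ∫⁻ t, ‖f t‖ₑ ^ 2 ≤ ∫⁻ τ, ‖timeFT f τ‖ₑ ^ 2 := by
  refine (lintegral_sq_le_lintegral_sq_fourier hf (integrable_fourier_of_timeFT hf hF)).trans ?_
  simp only [fourier_eq_timeFT]
  exact lintegral_comp_two_pi_mul_le (g := fun τ => ‖timeFT f τ‖ₑ ^ 2)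
    ((continuous_timeFT hf).enorm.measurable.pow_const 2)

theorem integrable_conj_mul_of_timeFT {g h : ℝ → ℂ} (hg : Integrable g)
    (hG : ∫⁻ τ, ‖timeFT g τ‖ₑ ≠ ∞) (hh : Integrable h) :
    Integrable fun t => conj (g t) * h t := by
  refine hh.bdd_mul (c := (∫⁻ τ, ‖timeFT g τ‖ₑ).toReal) hg.complex_conj.1 ?_
  filter_upwards [ae_enorm_le_lintegral_timeFT hg hG] with t ht
  rw [RCLike.norm_conj, ← toReal_enorm]
  exact ENNReal.toReal_mono hG ht

theorem enorm_timeFT_mul_conj_mul_le {f g h : ℝ → ℂ} (hf : Integrable f)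
    (hF : ∫⁻ τ, ‖timeFT f τ‖ₑ ≠ ∞) (hg : Integrable g) (hG : ∫⁻ τ, ‖timeFT g τ‖ₑ ≠ ∞)
    (hh : Integrable h) (τ : ℝ) :
    ‖timeFT (fun t => f t * (conj (g t) * h t)) τ‖ₑ ≤
      ∫⁻ σ, ∫⁻ σ', ‖timeFT f σ‖ₑ * ‖timeFT g σ'‖ₑ * ‖timeFT h (τ - σ + σ')‖ₑ := by
  have mf := (continuous_timeFT hf).measurable
  have mg := (continuous_timeFT hg).measurable
  have mh := (continuous_timeFT hh).measurable
  rw [timeFT_eq_fourier]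
  refine (enorm_fourier_mul_conj_mul_le hf (integrable_fourier_of_timeFT hf hF) hg
    (integrable_fourier_of_timeFT hg hG) hh (integrable_conj_mul_of_timeFT hg hG hh) _).trans ?_
  have e : ∀ η η' : ℝ, 2 * π * (τ / (2 * π) - η + η') = τ - 2 * π * η + 2 * π * η' := fun η η' => by
    field_simp
  simp only [fourier_eq_timeFT, e]
  have m : Measurable fun σ =>
      ∫⁻ σ', ‖timeFT f σ‖ₑ * ‖timeFT g σ'‖ₑ * ‖timeFT h (τ - σ + σ')‖ₑ :=
    Measurable.lintegral_prod_right' (f := fun p : ℝ × ℝ =>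
      ‖timeFT f p.1‖ₑ * ‖timeFT g p.2‖ₑ * ‖timeFT h (τ - p.1 + p.2)‖ₑ)
      (by fun_prop)
  refine le_trans (lintegral_mono fun η => ?_) (lintegral_comp_two_pi_mul_le m)
  exact lintegral_comp_two_pi_mul_le (g := fun σ' =>
    ‖timeFT f (2 * π * η)‖ₑ * ‖timeFT g σ'‖ₑ * ‖timeFT h (τ - 2 * π * η + σ')‖ₑ)
    (by fun_prop)

end TimeFourier

section Torus

open ComplexConjugate

theorem hasSum_conj_fourierCoeff_mul {V W : Torus → ℂ} (hV : Continuous V) (hW : Continuous W) :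
    HasSum (fun i => conj (fourierCoeff V i) * fourierCoeff W i)
      (∫ x, conj (V x) * W x ∂AddCircle.haarAddCircle) := by
  have h := fourierBasis.hasSum_inner_mul_inner
    (ContinuousMap.toLp 2 AddCircle.haarAddCircle ℂ (⟨V, hV⟩ : C(Torus, ℂ)))
    (ContinuousMap.toLp 2 AddCircle.haarAddCircle ℂ (⟨W, hW⟩ : C(Torus, ℂ)))
  rw [ContinuousMap.inner_toLp] at h
  convert h using 1
  · rfl
  · funext i
    rw [← inner_conj_symm, ← HilbertBasis.repr_apply_apply, ← HilbertBasis.repr_apply_apply,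
      fourierBasis_repr, fourierBasis_repr, fourierCoeff_toLp, fourierCoeff_toLp]
    rfl
  · exact integral_congr_ae (Filter.Eventually.of_forall fun x => mul_comm _ _)

theorem fourierCoeff_conj (V : Torus → ℂ) (i : ℤ) :
    fourierCoeff (fun x => conj (V x)) i = conj (fourierCoeff V (-i)) := by
  rw [fourierCoeff, fourierCoeff, ← integral_conj]
  refine integral_congr_ae (Filter.Eventually.of_forall fun x => ?_)
  simp only [smul_eq_mul, map_mul, neg_neg, fourier_neg]

theorem hasSum_fourierCoeff_mul {V W : Torus → ℂ} (hV : Continuous V) (hW : Continuous W) (k : ℤ) :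
    HasSum (fun i => fourierCoeff V (k - i) * fourierCoeff W i)
      (fourierCoeff (fun x => V x * W x) k) := by
  have h := hasSum_conj_fourierCoeff_mul (V := fun x => conj (V x) * fourier k x) (by fun_prop) hW
  convert h using 1
  · funext i
    congr 1
    rw [fourierCoeff, fourierCoeff, ← integral_conj]
    refine integral_congr_ae (Filter.Eventually.of_forall fun x => ?_)
    simp only [smul_eq_mul, map_mul, sub_eq_add_neg, fourier_neg, fourier_add,
      Complex.conj_conj]
    ring
  · rw [fourierCoeff]
    refine integral_congr_ae (Filter.Eventually.of_forall fun x => ?_)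
    simp only [smul_eq_mul, map_mul, fourier_neg, Complex.conj_conj]
    ring

theorem fourierCoeff_mul_conj_mul {U₁ U₂ U₃ : Torus → ℂ} (h₁ : Continuous U₁) (h₂ : Continuous U₂)
    (h₃ : Continuous U₃) (k : ℤ)
    (hs : Summable fun p : ℤ × ℤ => fourierCoeff U₁ p.1 *
      (conj (fourierCoeff U₂ p.2) * fourierCoeff U₃ (k - p.1 + p.2))) :
    fourierCoeff (fun x => U₁ x * conj (U₂ x) * U₃ x) k = ∑' p : ℤ × ℤ, fourierCoeff U₁ p.1 *
      (conj (fourierCoeff U₂ p.2) * fourierCoeff U₃ (k - p.1 + p.2)) := by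
  have inner : ∀ i, HasSum (fun m => conj (fourierCoeff U₂ m) * fourierCoeff U₃ (i + m))
      (fourierCoeff (fun x => conj (U₂ x) * U₃ x) i) := fun i => by
    have h := hasSum_fourierCoeff_mul (V := fun x => conj (U₂ x)) (by fun_prop) h₃ i
    rw [← (Equiv.addLeft i).hasSum_iff] at h
    convert h using 1
    funext m
    simp [fourierCoeff_conj]
  have outer : HasSum (fun m => fourierCoeff U₁ m *
      fourierCoeff (fun x => conj (U₂ x) * U₃ x) (k - m))
      (fourierCoeff (fun x => U₁ x * conj (U₂ x) * U₃ x) k) := by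
    have h := hasSum_fourierCoeff_mul (W := fun x => conj (U₂ x) * U₃ x) h₁ (by fun_prop) k
    rw [← (Equiv.subLeft k).hasSum_iff] at h
    convert h using 1
    · funext m
      simp
    · simp only [mul_assoc]
  rw [hs.tsum_prod, ← outer.tsum_eq]
  refine tsum_congr fun m => ?_
  simp only [tsum_mul_left, (inner (k - m)).tsum_eq]

end Torus

section Modes

open ComplexConjugate

theorem enorm_timeFT_fourierCoeff_le {u₁ u₂ u₃ : ℝ → Torus → ℂ} (c₁ : ∀ t, Continuous (u₁ t))
    (c₂ : ∀ t, Continuous (u₂ t)) (c₃ : ∀ t, Continuous (u₃ t))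
    (i₁ : ∀ k : ℤ, Integrable fun t => fourierCoeff (u₁ t) k)
    (i₂ : ∀ k : ℤ, Integrable fun t => fourierCoeff (u₂ t) k)
    (i₃ : ∀ k : ℤ, Integrable fun t => fourierCoeff (u₃ t) k) (k : ℤ)
    (hs : ∑' p : ℤ × ℤ, ∫⁻ t, ‖fourierCoeff (u₁ t) p.1 *
      (conj (fourierCoeff (u₂ t) p.2) * fourierCoeff (u₃ t) (k - p.1 + p.2))‖ₑ ≠ ∞) (τ : ℝ) :
    ‖timeFT (fun t => fourierCoeff (fun x => u₁ t x * conj (u₂ t x) * u₃ t x) k) τ‖ₑ ≤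
      ∑' p : ℤ × ℤ, ‖timeFT (fun t => fourierCoeff (u₁ t) p.1 *
        (conj (fourierCoeff (u₂ t) p.2) * fourierCoeff (u₃ t) (k - p.1 + p.2))) τ‖ₑ := by
  set g : ℤ × ℤ → ℝ → ℂ := fun p t => fourierCoeff (u₁ t) p.1 *
    (conj (fourierCoeff (u₂ t) p.2) * fourierCoeff (u₃ t) (k - p.1 + p.2))
  have hg : ∀ p, AEStronglyMeasurable (g p) := fun p =>
    (i₁ _).1.mul ((i₂ _).complex_conj.1.mul (i₃ _).1)
  have he : ∀ t : ℝ, ‖Complex.exp (-Complex.I * (τ : ℂ) * (t : ℂ))‖ₑ = 1 := fun t => by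
    rw [← ofReal_norm, Complex.norm_exp]
    simp
  have hsum : ∀ᵐ t, Summable fun p => g p t := by
    rw [← lintegral_tsum fun p => (hg p).enorm] at hs
    filter_upwards [ae_lt_top' (AEMeasurable.tsum fun p => (hg p).enorm) hs] with t ht
    exact Summable.of_norm (by simpa using ENNReal.summable_toReal ht.ne)
  have h1 : timeFT (fun t => fourierCoeff (fun x => u₁ t x * conj (u₂ t x) * u₃ t x) k) τ =
      ∫ t : ℝ, ∑' p, Complex.exp (-Complex.I * (τ : ℂ) * (t : ℂ)) * g p t := by
    refine integral_congr_ae ?_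
    filter_upwards [hsum] with t ht
    rw [fourierCoeff_mul_conj_mul (c₁ t) (c₂ t) (c₃ t) k ht, tsum_mul_left]
  have h2 : ∑' p, ∫⁻ t : ℝ, ‖Complex.exp (-Complex.I * (τ : ℂ) * (t : ℂ)) * g p t‖ₑ ≠ ∞ := by
    simp only [enorm_mul (Complex.exp _), he, one_mul]
    exact hs
  rw [h1, integral_tsum (f := fun p (t : ℝ) => Complex.exp (-Complex.I * (τ : ℂ) * (t : ℂ)) * g p t)
    (fun p => (Continuous.aestronglyMeasurable (by fun_prop)).mul (hg p)) h2]
  exact enorm_tsum_le_tsum_enorm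

/-- The squared norm of a single Fourier mode, weighted by the modulation. -/
def modeEnergy (b c : ℝ) (f : ℝ → ℂ) : ℝ≥0∞ :=
  ∫⁻ τ, ENNReal.ofReal ((1 + |τ + c| ^ 2) ^ b) * ‖timeFT f τ‖ₑ ^ 2

theorem lintegral_sq_le_modeEnergy {b : ℝ} (hb : 0 ≤ b) (c : ℝ) (f : ℝ → ℂ) :
    ∫⁻ τ, ‖timeFT f τ‖ₑ ^ 2 ≤ modeEnergy b c f := by
  refine lintegral_mono fun τ => le_mul_of_one_le_left' ?_
  rw [ENNReal.one_le_ofReal]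
  exact Real.one_le_rpow (by linarith [sq_nonneg |τ + c|]) hb

theorem sq_lintegral_le_modeEnergy (b c : ℝ) {f : ℝ → ℂ} (hf : Integrable f) :
    (∫⁻ τ, ‖timeFT f τ‖ₑ) ^ 2 ≤
      (∫⁻ x : ℝ, ENNReal.ofReal ((1 + |x| ^ 2) ^ (-b))) * modeEnergy b c f := by
  have hm := (continuous_timeFT hf).measurable
  rw [← lintegral_add_right_eq_self (fun x : ℝ => ENNReal.ofReal ((1 + |x| ^ 2) ^ (-b))) c]
  refine sq_lintegral_le_of_sq_le (by fun_prop) (by fun_prop) fun τ => ?_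
  rw [← mul_assoc, ← ENNReal.ofReal_mul (by positivity), ← Real.rpow_add (by positivity)]
  simp

theorem sq_lintegral_mul_conj_mul_le {b : ℝ} (hb : 0 ≤ b) {f g h : ℝ → ℂ} (hf : Integrable f)
    (hg : Integrable g) (hh : Integrable h) (hF : ∫⁻ τ, ‖timeFT f τ‖ₑ ≠ ∞)
    (hG : ∫⁻ τ, ‖timeFT g τ‖ₑ ≠ ∞) (hH : ∫⁻ τ, ‖timeFT h τ‖ₑ ≠ ∞) (c₁ c₂ c₃ : ℝ) :
    (∫⁻ t, ‖f t * (conj (g t) * h t)‖ₑ) ^ 2 ≤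
      (∫⁻ x : ℝ, ENNReal.ofReal ((1 + |x| ^ 2) ^ (-b))) *
        (modeEnergy b c₁ f * modeEnergy b c₂ g * modeEnergy b c₃ h) := by
  calc (∫⁻ t, ‖f t * (conj (g t) * h t)‖ₑ) ^ 2
      ≤ (∫⁻ t, ‖f t‖ₑ * ‖g t‖ₑ * ∫⁻ τ, ‖timeFT h τ‖ₑ) ^ 2 := by
        gcongr ?_ ^ 2
        refine lintegral_mono_ae ?_
        filter_upwards [ae_enorm_le_lintegral_timeFT hh hH] with t ht
        rw [enorm_mul, enorm_mul, RCLike.enorm_conj, ← mul_assoc]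
        gcongr
    _ = (∫⁻ t, ‖f t‖ₑ * ‖g t‖ₑ) ^ 2 * (∫⁻ τ, ‖timeFT h τ‖ₑ) ^ 2 := by
        rw [lintegral_mul_const' _ _ hH, mul_pow]
    _ ≤ (modeEnergy b c₁ f * modeEnergy b c₂ g) *
        ((∫⁻ x : ℝ, ENNReal.ofReal ((1 + |x| ^ 2) ^ (-b))) * modeEnergy b c₃ h) := by
        gcongr
        · refine (sq_lintegral_mul_le hf.1.enorm hg.1.enorm).trans ?_
          gcongr
          · exact (lintegral_sq_le_lintegral_sq_timeFT hf hF).trans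
              (lintegral_sq_le_modeEnergy hb c₁ f)
          · exact (lintegral_sq_le_lintegral_sq_timeFT hg hG).trans
              (lintegral_sq_le_modeEnergy hb c₂ g)
        · exact sq_lintegral_le_modeEnergy b c₃ hh
    _ = _ := by ring

end Modes

section Lattice

theorem triConv_count_ne_top {s : ℝ} (hs : 1 / 4 < s) {A₁ A₂ A₃ : ℤ → ℝ≥0∞}
    (h₁ : ∑' k : ℤ, ENNReal.ofReal ((1 + |(k : ℝ)| ^ 2) ^ s) * A₁ k ^ 2 ≠ ∞)
    (h₂ : ∑' k : ℤ, ENNReal.ofReal ((1 + |(k : ℝ)| ^ 2) ^ s) * A₂ k ^ 2 ≠ ∞)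
    (h₃ : ∑' k : ℤ, ENNReal.ofReal ((1 + |(k : ℝ)| ^ 2) ^ s) * A₃ k ^ 2 ≠ ∞) (k : ℤ) :
    ∑' m : ℤ, ∑' n : ℤ, A₁ m * A₂ n * A₃ (k - m + n) ≠ ∞ := by
  set w : ℤ → ℝ≥0∞ := fun k => ENNReal.ofReal ((1 + |(k : ℝ)| ^ 2) ^ s)
  have hw0 : ∀ k, w k ≠ 0 := fun k => by
    simp only [w, ne_eq, ENNReal.ofReal_eq_zero, not_le]
    positivity
  have hwt : ∀ k, w k ≠ ∞ := fun k => ENNReal.ofReal_ne_top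
  have hwinv : ∀ k, (w k)⁻¹ ^ 2 = ENNReal.ofReal ((1 + (k : ℝ) ^ 2) ^ (-(2 * s))) := fun k => by
    simp only [w]
    rw [← ENNReal.ofReal_inv_of_pos (by positivity), ← ENNReal.ofReal_pow (by positivity),
      ← Real.rpow_neg (by positivity), ← Real.rpow_mul_natCast (by positivity), sq_abs]
    congr 2
    push_cast
    ring
  have hfin : ∑' k, (w k)⁻¹ ^ 2 ≠ ∞ := by
    simp only [hwinv]
    exact (summable_int_one_add_sq_rpow (p := 2 * s) (by linarith)).tsum_ofReal_ne_top
  have hK : ∀ y, ∫⁻ x, (w x)⁻¹ * (w (y - x))⁻¹ ∂Measure.count ≤ 2 * ∑' k, (w k)⁻¹ ^ 2 := fun y => by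
    rw [lintegral_count, two_mul]
    nth_rw 2 [← (Equiv.subLeft y).tsum_eq]
    rw [← ENNReal.tsum_add]
    refine ENNReal.tsum_le_tsum fun x => ?_
    simp only [Equiv.subLeft_apply]
    rcases le_total (w x)⁻¹ (w (y - x))⁻¹ with h | h
    · exact le_add_right (by rw [sq]; exact mul_le_mul' h le_rfl)
    · exact le_add_left (by rw [sq]; exact mul_le_mul' le_rfl h)
  have key := lintegral_sq_triConv_le (μ := (Measure.count : Measure ℤ)) (w₀ := w) (w₁ := w)
    (l := fun _ => 1) (C := 1) (F₁ := A₁) (F₂ := A₂) (F₃ := A₃) .of_discrete .of_discrete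
    .of_discrete hw0 hwt hw0 hwt hK (fun _ _ _ => by rw [one_mul, add_assoc]; exact le_self_add)
    (fun x => by simp) .of_discrete .of_discrete .of_discrete
  simp only [lintegral_count, one_mul] at key
  have hR : ∑' k, (w k)⁻¹ * triConv Measure.count A₁ A₂ A₃ k ^ 2 ≠ ∞ := by
    refine ne_top_of_le_ne_top ?_ key
    finiteness
  have hk := ENNReal.ne_top_of_tsum_ne_top hR k
  intro htop
  refine hk ?_
  rw [triConv]
  simp only [lintegral_count]
  rw [htop]
  simp [hwt k]

end Lattice

section Trilinear

open ComplexConjugate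

/-- The integral defining the squared norm of `X^{s,b}_α`, without its normalization. -/
def bourgainIntegral (α s b : ℝ) (u : ℝ → Torus → ℂ) : ℝ≥0∞ :=
  ∑' k : ℤ, ∫⁻ τ : ℝ, bourgainWeight α s b (k, τ) *
    ‖timeFT (fun t => fourierCoeff (u t) k) τ‖ₑ ^ 2

theorem bourgainNormSq_eq (α s b : ℝ) (u : ℝ → Torus → ℂ) :
    bourgainNormSq α s b u = (ENNReal.ofReal (2 * π))⁻¹ * bourgainIntegral α s b u := rfl

theorem bourgainIntegral_eq_tsum_modeEnergy (α s b : ℝ) (u : ℝ → Torus → ℂ) :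
    bourgainIntegral α s b u = ∑' k : ℤ, ENNReal.ofReal ((1 + |(k : ℝ)| ^ 2) ^ s) *
      modeEnergy b (|(k : ℝ)| ^ α) (fun t => fourierCoeff (u t) k) := by
  refine tsum_congr fun k => ?_
  rw [modeEnergy, ← lintegral_const_mul' _ _ ENNReal.ofReal_ne_top]
  refine lintegral_congr fun τ => ?_
  rw [bourgainWeight, ENNReal.ofReal_mul (by positivity), mul_assoc]

theorem measurable_enorm_timeFT_fourierCoeff {u : ℝ → Torus → ℂ}
    (hu : ∀ k : ℤ, Integrable fun t => fourierCoeff (u t) k) :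
    Measurable fun p : ℤ × ℝ => ‖timeFT (fun t => fourierCoeff (u t) p.1) p.2‖ₑ :=
  measurable_from_prod_countable_right fun k => (continuous_timeFT (hu k)).enorm.measurable

theorem bourgainIntegral_eq_lintegral (α s b : ℝ) {u : ℝ → Torus → ℂ}
    (hu : ∀ k : ℤ, Integrable fun t => fourierCoeff (u t) k) :
    bourgainIntegral α s b u = ∫⁻ p, bourgainWeight α s b p *
      ‖timeFT (fun t => fourierCoeff (u t) p.1) p.2‖ₑ ^ 2 ∂dualMeasure := by
  have := measurable_enorm_timeFT_fourierCoeff hu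
  rw [lintegral_dualMeasure (by fun_prop)]
  rfl

theorem modeEnergy_ne_top {α s b : ℝ} {u : ℝ → Torus → ℂ} (h : bourgainIntegral α s b u ≠ ∞)
    (k : ℤ) : modeEnergy b (|(k : ℝ)| ^ α) (fun t => fourierCoeff (u t) k) ≠ ∞ := by
  rw [bourgainIntegral_eq_tsum_modeEnergy] at h
  intro htop
  refine ENNReal.ne_top_of_tsum_ne_top h k ?_
  rw [htop, ENNReal.mul_top]
  rw [ne_eq, ENNReal.ofReal_eq_zero, not_le]
  positivity

theorem lintegral_timeFT_ne_top {α s b : ℝ} (hb : 1 / 2 < b) {u : ℝ → Torus → ℂ}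
    (hu : ∀ k : ℤ, Integrable fun t => fourierCoeff (u t) k)
    (h : bourgainIntegral α s b u ≠ ∞) (k : ℤ) :
    ∫⁻ τ, ‖timeFT (fun t => fourierCoeff (u t) k) τ‖ₑ ≠ ∞ := by
  have h1 := (sq_lintegral_le_modeEnergy b (|(k : ℝ)| ^ α) (hu k)).trans_lt
    (ENNReal.mul_lt_top (lintegral_one_add_sq_rpow_lt_top hb) (modeEnergy_ne_top h k).lt_top)
  intro htop
  rw [htop] at h1
  simp at h1

theorem ae_fourierCoeff_eq_zero {α s b : ℝ} {u : ℝ → Torus → ℂ}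
    (hu : ∀ k : ℤ, Integrable fun t => fourierCoeff (u t) k)
    (h : bourgainIntegral α s b u = 0) (k : ℤ) : ∀ᵐ t, fourierCoeff (u t) k = 0 := by
  rw [bourgainIntegral, ENNReal.tsum_eq_zero] at h
  have hm := (continuous_timeFT (hu k)).measurable
  have hw : Measurable fun τ : ℝ => bourgainWeight α s b (k, τ) := by fun_prop
  have h0 := (lintegral_eq_zero_iff (by fun_prop)).1 (h k)
  have h1 : ∫⁻ τ, ‖timeFT (fun t => fourierCoeff (u t) k) τ‖ₑ = 0 := by
    rw [lintegral_eq_zero_iff (by fun_prop)]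
    filter_upwards [h0] with τ hτ
    simpa [bourgainWeight_ne_zero] using hτ
  filter_upwards [ae_enorm_le_lintegral_timeFT (hu k) (by simp [h1])] with t ht
  simpa [h1] using ht

theorem triConv_dualMeasure {F₁ F₂ F₃ : ℤ × ℝ → ℝ≥0∞} (h₁ : Measurable F₁) (h₂ : Measurable F₂)
    (h₃ : Measurable F₃) (k : ℤ) (τ : ℝ) :
    triConv dualMeasure F₁ F₂ F₃ (k, τ) = ∑' m : ℤ, ∑' n : ℤ, ∫⁻ σ, ∫⁻ σ',
      F₁ (m, σ) * F₂ (n, σ') * F₃ (k - m + n, τ - σ + σ') := by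
  have mq : Measurable fun q : (ℤ × ℝ) × (ℤ × ℝ) => F₁ q.1 * F₂ q.2 * F₃ ((k, τ) - q.1 + q.2) := by
    fun_prop
  rw [triConv, lintegral_dualMeasure mq.lintegral_prod_right']
  refine tsum_congr fun m => ?_
  have h : ∀ σ, ∫⁻ y, F₁ (m, σ) * F₂ y * F₃ ((k, τ) - (m, σ) + y) ∂dualMeasure =
      ∑' n : ℤ, ∫⁻ σ', F₁ (m, σ) * F₂ (n, σ') * F₃ (k - m + n, τ - σ + σ') := fun σ =>
    lintegral_dualMeasure (mq.comp measurable_prodMk_left)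
  simp only [h]
  rw [lintegral_tsum]
  intro n
  refine Measurable.aemeasurable (Measurable.lintegral_prod_right' (f := fun r : ℝ × ℝ =>
    F₁ (m, r.1) * F₂ (n, r.2) * F₃ (k - m + n, τ - r.1 + r.2)) ?_)
  fun_prop

variable {α s b : ℝ} {u₁ u₂ u₃ : ℝ → Torus → ℂ}

theorem tsum_lintegral_fourierCoeff_ne_top (hs : 1 / 4 < s) (hb : 1 / 2 < b)
    (i₁ : ∀ k : ℤ, Integrable fun t => fourierCoeff (u₁ t) k)
    (i₂ : ∀ k : ℤ, Integrable fun t => fourierCoeff (u₂ t) k)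
    (i₃ : ∀ k : ℤ, Integrable fun t => fourierCoeff (u₃ t) k)
    (h₁ : bourgainIntegral α s b u₁ ≠ ∞) (h₂ : bourgainIntegral α s b u₂ ≠ ∞)
    (h₃ : bourgainIntegral α s b u₃ ≠ ∞) (k : ℤ) :
    ∑' p : ℤ × ℤ, ∫⁻ t, ‖fourierCoeff (u₁ t) p.1 *
      (conj (fourierCoeff (u₂ t) p.2) * fourierCoeff (u₃ t) (k - p.1 + p.2))‖ₑ ≠ ∞ := by
  set A : (ℝ → Torus → ℂ) → ℤ → ℝ≥0∞ := fun u k =>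
    modeEnergy b (|(k : ℝ)| ^ α) (fun t => fourierCoeff (u t) k) ^ (1 / 2 : ℝ)
  have hA : ∀ u k, A u k ^ 2 = modeEnergy b (|(k : ℝ)| ^ α) (fun t => fourierCoeff (u t) k) :=
    fun u k => by
      simp only [A]
      rw [← ENNReal.rpow_natCast, ← ENNReal.rpow_mul]
      norm_num
  have hN : ∀ u, bourgainIntegral α s b u ≠ ∞ →
      ∑' k : ℤ, ENNReal.ofReal ((1 + |(k : ℝ)| ^ 2) ^ s) * A u k ^ 2 ≠ ∞ := fun u hu => by
    simpa only [hA, ← bourgainIntegral_eq_tsum_modeEnergy] using hu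
  set K : ℝ≥0∞ := (∫⁻ x : ℝ, ENNReal.ofReal ((1 + |x| ^ 2) ^ (-b))) ^ (1 / 2 : ℝ) with hK
  have hKt : K ≠ ∞ :=
    ENNReal.rpow_ne_top_of_nonneg (by norm_num) (lintegral_one_add_sq_rpow_lt_top hb).ne
  have hK2 : K ^ 2 = ∫⁻ x : ℝ, ENNReal.ofReal ((1 + |x| ^ 2) ^ (-b)) := by
    rw [hK, ← ENNReal.rpow_natCast, ← ENNReal.rpow_mul]
    norm_num
  have hle : ∀ p : ℤ × ℤ, ∫⁻ t, ‖fourierCoeff (u₁ t) p.1 *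
      (conj (fourierCoeff (u₂ t) p.2) * fourierCoeff (u₃ t) (k - p.1 + p.2))‖ₑ ≤
      K * (A u₁ p.1 * A u₂ p.2 * A u₃ (k - p.1 + p.2)) := fun p => by
    refine (ENNReal.pow_le_pow_left_iff two_ne_zero).1 ?_
    refine (sq_lintegral_mul_conj_mul_le (b := b) (by linarith) (i₁ _) (i₂ _) (i₃ _)
      (lintegral_timeFT_ne_top hb i₁ h₁ _) (lintegral_timeFT_ne_top hb i₂ h₂ _)
      (lintegral_timeFT_ne_top hb i₃ h₃ _) (|(p.1 : ℝ)| ^ α) (|(p.2 : ℝ)| ^ α)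
      (|((k - p.1 + p.2 : ℤ) : ℝ)| ^ α)).trans_eq ?_
    rw [mul_pow, mul_pow, mul_pow, hK2, hA, hA, hA]
  refine ne_top_of_le_ne_top ?_ (ENNReal.tsum_le_tsum hle)
  rw [ENNReal.tsum_mul_left,
    ENNReal.tsum_prod (f := fun m n => A u₁ m * A u₂ n * A u₃ (k - m + n))]
  exact ENNReal.mul_ne_top hKt (triConv_count_ne_top hs (hN _ h₁) (hN _ h₂) (hN _ h₃) k)

theorem enorm_timeFT_fourierCoeff_le_triConv (hs : 1 / 4 < s) (hb : 1 / 2 < b)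
    (c₁ : ∀ t, Continuous (u₁ t)) (c₂ : ∀ t, Continuous (u₂ t)) (c₃ : ∀ t, Continuous (u₃ t))
    (i₁ : ∀ k : ℤ, Integrable fun t => fourierCoeff (u₁ t) k)
    (i₂ : ∀ k : ℤ, Integrable fun t => fourierCoeff (u₂ t) k)
    (i₃ : ∀ k : ℤ, Integrable fun t => fourierCoeff (u₃ t) k)
    (h₁ : bourgainIntegral α s b u₁ ≠ ∞) (h₂ : bourgainIntegral α s b u₂ ≠ ∞)
    (h₃ : bourgainIntegral α s b u₃ ≠ ∞) (p : ℤ × ℝ) :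
    ‖timeFT (fun t => fourierCoeff (fun x => u₁ t x * conj (u₂ t x) * u₃ t x) p.1) p.2‖ₑ ≤
      triConv dualMeasure (fun p => ‖timeFT (fun t => fourierCoeff (u₁ t) p.1) p.2‖ₑ)
        (fun p => ‖timeFT (fun t => fourierCoeff (u₂ t) p.1) p.2‖ₑ)
        (fun p => ‖timeFT (fun t => fourierCoeff (u₃ t) p.1) p.2‖ₑ) p := by
  obtain ⟨k, τ⟩ := p
  rw [triConv_dualMeasure (measurable_enorm_timeFT_fourierCoeff i₁)
    (measurable_enorm_timeFT_fourierCoeff i₂) (measurable_enorm_timeFT_fourierCoeff i₃)]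
  refine (enorm_timeFT_fourierCoeff_le c₁ c₂ c₃ i₁ i₂ i₃ k
    (tsum_lintegral_fourierCoeff_ne_top hs hb i₁ i₂ i₃ h₁ h₂ h₃ k) τ).trans ?_
  have hle : ∀ p : ℤ × ℤ, ‖timeFT (fun t => fourierCoeff (u₁ t) p.1 *
      (conj (fourierCoeff (u₂ t) p.2) * fourierCoeff (u₃ t) (k - p.1 + p.2))) τ‖ₑ ≤
      ∫⁻ σ, ∫⁻ σ', ‖timeFT (fun t => fourierCoeff (u₁ t) p.1) σ‖ₑ *
        ‖timeFT (fun t => fourierCoeff (u₂ t) p.2) σ'‖ₑ *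
        ‖timeFT (fun t => fourierCoeff (u₃ t) (k - p.1 + p.2)) (τ - σ + σ')‖ₑ := fun p =>
    enorm_timeFT_mul_conj_mul_le (i₁ p.1) (lintegral_timeFT_ne_top hb i₁ h₁ _) (i₂ p.2)
      (lintegral_timeFT_ne_top hb i₂ h₂ _) (i₃ (k - p.1 + p.2)) τ
  refine (ENNReal.tsum_le_tsum hle).trans_eq ?_
  exact ENNReal.tsum_prod (f := fun m n => ∫⁻ σ, ∫⁻ σ',
    ‖timeFT (fun t => fourierCoeff (u₁ t) m) σ‖ₑ * ‖timeFT (fun t => fourierCoeff (u₂ t) n) σ'‖ₑ *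
      ‖timeFT (fun t => fourierCoeff (u₃ t) (k - m + n)) (τ - σ + σ')‖ₑ)

theorem timeFT_fourierCoeff_eq_zero (c₁ : ∀ t, Continuous (u₁ t)) (c₂ : ∀ t, Continuous (u₂ t))
    (c₃ : ∀ t, Continuous (u₃ t)) (i₁ : ∀ k : ℤ, Integrable fun t => fourierCoeff (u₁ t) k)
    (i₂ : ∀ k : ℤ, Integrable fun t => fourierCoeff (u₂ t) k)
    (i₃ : ∀ k : ℤ, Integrable fun t => fourierCoeff (u₃ t) k)
    (h : bourgainIntegral α s b u₁ = 0 ∨ bourgainIntegral α s b u₂ = 0 ∨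
      bourgainIntegral α s b u₃ = 0) (k : ℤ) (τ : ℝ) :
    timeFT (fun t => fourierCoeff (fun x => u₁ t x * conj (u₂ t x) * u₃ t x) k) τ = 0 := by
  have hz : ∀ p : ℤ × ℤ, (fun t => fourierCoeff (u₁ t) p.1 *
      (conj (fourierCoeff (u₂ t) p.2) * fourierCoeff (u₃ t) (k - p.1 + p.2))) =ᵐ[volume] 0 := by
    intro p
    rcases h with h | h | h
    · filter_upwards [ae_fourierCoeff_eq_zero i₁ h p.1] with t ht
      simp [ht]
    · filter_upwards [ae_fourierCoeff_eq_zero i₂ h p.2] with t ht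
      simp [ht]
    · filter_upwards [ae_fourierCoeff_eq_zero i₃ h (k - p.1 + p.2)] with t ht
      simp [ht]
  have hz1 : ∀ p : ℤ × ℤ, ∫⁻ t, ‖fourierCoeff (u₁ t) p.1 *
      (conj (fourierCoeff (u₂ t) p.2) * fourierCoeff (u₃ t) (k - p.1 + p.2))‖ₑ = 0 := fun p => by
    refine (lintegral_congr_ae (g := fun _ => 0) ?_).trans lintegral_zero
    filter_upwards [hz p] with t ht
    simpa using ht
  have hz2 : ∀ p : ℤ × ℤ, timeFT (fun t => fourierCoeff (u₁ t) p.1 *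
      (conj (fourierCoeff (u₂ t) p.2) * fourierCoeff (u₃ t) (k - p.1 + p.2))) τ = 0 := fun p => by
    refine integral_eq_zero_of_ae ?_
    filter_upwards [hz p] with t ht
    simpa using ht
  have := enorm_timeFT_fourierCoeff_le c₁ c₂ c₃ i₁ i₂ i₃ k (by simp only [hz1]; simp) τ
  simp only [hz2] at this
  simpa using this

end Trilinear

/-- Trilinear estimate in Bourgain spaces:
`‖u₁ ū₂ u₃‖_{X^{γ,-b'}_α} ≤ C ‖u₁‖_{X^{γ,b}_α} ‖u₂‖_{X^{γ,b}_α} ‖u₃‖_{X^{γ,b}_α}`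
(both sides squared). -/
theorem trilinear_bourgain (α γ b b' : ℝ) (hα : 2 / 3 < α) (hα1 : α < 1)
    (hγ : 1 / 2 - α / 4 < γ) (hb : 1 / 2 < b) (hb' : 1 / 4 < b') (hbb' : b' < b) :
    ∃ C > 0, ∀ u₁ u₂ u₃ : ℝ → Torus → ℂ,
      (∀ t, Continuous (u₁ t)) → (∀ t, Continuous (u₂ t)) → (∀ t, Continuous (u₃ t)) →
      (∀ k : ℤ, Integrable (fun t => fourierCoeff (u₁ t) k)) →
      (∀ k : ℤ, Integrable (fun t => fourierCoeff (u₂ t) k)) →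
      (∀ k : ℤ, Integrable (fun t => fourierCoeff (u₃ t) k)) →
      bourgainNormSq α γ (-b')
          (fun t x => u₁ t x * starRingEnd ℂ (u₂ t x) * u₃ t x) ≤
        ENNReal.ofReal C ^ 2 *
          (bourgainNormSq α γ b u₁ * bourgainNormSq α γ b u₂ * bourgainNormSq α γ b u₃) := by
  obtain ⟨K, hK, hest⟩ := exists_lintegral_triConv_le (by linarith) hα1 hγ hb hb' hbb'.le
  have hπ : ENNReal.ofReal (2 * π) ≠ 0 := by simp [Real.pi_pos]
  have hKπ : K * ENNReal.ofReal (2 * π) ^ 2 ≠ ∞ := by finiteness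
  refine ⟨(K * ENNReal.ofReal (2 * π) ^ 2).toReal + 1, by positivity,
    fun u₁ u₂ u₃ c₁ c₂ c₃ i₁ i₂ i₃ => ?_⟩
  have hC : K * ENNReal.ofReal (2 * π) ^ 2 ≤
      ENNReal.ofReal ((K * ENNReal.ofReal (2 * π) ^ 2).toReal + 1) ^ 2 := by
    rw [ENNReal.ofReal_add (by positivity) zero_le_one, ENNReal.ofReal_toReal hKπ,
      ENNReal.ofReal_one]
    exact le_self_add.trans (le_self_pow le_add_self two_ne_zero)
  simp only [bourgainNormSq_eq]
  by_cases h0 : bourgainIntegral α γ b u₁ = 0 ∨ bourgainIntegral α γ b u₂ = 0 ∨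
      bourgainIntegral α γ b u₃ = 0
  · have hz := timeFT_fourierCoeff_eq_zero c₁ c₂ c₃ i₁ i₂ i₃ h0
    simp [bourgainIntegral, hz]
  push Not at h0
  obtain ⟨z₁, z₂, z₃⟩ := h0
  have hCpos : ENNReal.ofReal ((K * ENNReal.ofReal (2 * π) ^ 2).toReal + 1) ^ 2 ≠ 0 := by
    refine pow_ne_zero 2 ?_
    rw [ne_eq, ENNReal.ofReal_eq_zero, not_le]
    positivity
  by_cases ht : bourgainIntegral α γ b u₁ ≠ ∞ ∧ bourgainIntegral α γ b u₂ ≠ ∞ ∧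
      bourgainIntegral α γ b u₃ ≠ ∞
  · obtain ⟨h₁, h₂, h₃⟩ := ht
    have hF := hest _ _ _ (measurable_enorm_timeFT_fourierCoeff i₁)
      (measurable_enorm_timeFT_fourierCoeff i₂) (measurable_enorm_timeFT_fourierCoeff i₃)
    rw [← bourgainIntegral_eq_lintegral α γ b i₁, ← bourgainIntegral_eq_lintegral α γ b i₂,
      ← bourgainIntegral_eq_lintegral α γ b i₃] at hF
    have hL : bourgainIntegral α γ (-b') (fun t x => u₁ t x * starRingEnd ℂ (u₂ t x) * u₃ t x) ≤
        K * (bourgainIntegral α γ b u₁ * bourgainIntegral α γ b u₂ * bourgainIntegral α γ b u₃) := by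
      refine le_trans ?_ hF
      rw [lintegral_dualMeasure]
      · refine ENNReal.tsum_le_tsum fun k => lintegral_mono fun τ => ?_
        gcongr
        exact enorm_timeFT_fourierCoeff_le_triConv (by linarith) hb c₁ c₂ c₃ i₁ i₂ i₃ h₁ h₂ h₃
          (k, τ)
      · exact (measurable_bourgainWeight _ _ _).mul ((measurable_triConv
          (measurable_enorm_timeFT_fourierCoeff i₁) (measurable_enorm_timeFT_fourierCoeff i₂)
          (measurable_enorm_timeFT_fourierCoeff i₃)).pow_const 2)
    set c := ENNReal.ofReal (2 * π)
    have hcc : c⁻¹ * c = 1 := ENNReal.inv_mul_cancel hπ ENNReal.ofReal_ne_top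
    calc c⁻¹ * _ ≤ c⁻¹ * (K * (bourgainIntegral α γ b u₁ * bourgainIntegral α γ b u₂ *
          bourgainIntegral α γ b u₃)) := by gcongr
      _ = (c⁻¹ * c) ^ 2 * (c⁻¹ * (K * (bourgainIntegral α γ b u₁ * bourgainIntegral α γ b u₂ *
          bourgainIntegral α γ b u₃))) := by rw [hcc, one_pow, one_mul]
      _ = (K * c ^ 2) * (c⁻¹ * bourgainIntegral α γ b u₁ * (c⁻¹ * bourgainIntegral α γ b u₂) *
          (c⁻¹ * bourgainIntegral α γ b u₃)) := by ring
      _ ≤ _ := by gcongr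
  · have hci : (ENNReal.ofReal (2 * π))⁻¹ ≠ 0 := ENNReal.inv_ne_zero.2 ENNReal.ofReal_ne_top
    refine le_of_le_of_eq le_top (Eq.symm ?_)
    have n₁ := mul_ne_zero hci z₁
    have n₂ := mul_ne_zero hci z₂
    have n₃ := mul_ne_zero hci z₃
    have e : bourgainIntegral α γ b u₁ = ∞ ∨ bourgainIntegral α γ b u₂ = ∞ ∨
        bourgainIntegral α γ b u₃ = ∞ := by tauto
    rcases e with e | e | e
    · rw [e, ENNReal.mul_top hci, ENNReal.top_mul n₂, ENNReal.top_mul n₃, ENNReal.mul_top hCpos]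
    · rw [e, ENNReal.mul_top hci, ENNReal.mul_top n₁, ENNReal.top_mul n₃, ENNReal.mul_top hCpos]
    · rw [e, ENNReal.mul_top hci, ENNReal.mul_top (mul_ne_zero n₁ n₂), ENNReal.mul_top hCpos]

end
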